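/- Let f : S³ → (0, ∞) be a smooth function on the unit sphere S³ ⊂ ℝ⁴ and let S := {√(f(p))·p : p ∈ S³} be the corresponding star-shaped hypersurface. Then the contact form λ_st|TS has a closed Reeb orbit: there exist T > 0 and a nonconstant smooth map γ : ℝ → ℝ⁴ with image in S such that for all t ∈ ℝ one has γ(t + T) = γ(t), γ′(t) ∈ T_{γ(t)}S, ω_st(γ′(t), v) = 0 for all v ∈ T_{γ(t)}S, and λ_st(γ(t))(γ′(t)) = 1. -/

import Mathlib

noncomputable section

open scoped RealInnerProductSpace ContDiff
open Real

/-- ℝ⁴ with the Euclidean inner product. -/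
abbrev R4 : Type := EuclideanSpace ℝ (Fin 4)

/-- The standard symplectic form ω_st = dx₁∧dy₁ + dx₂∧dy₂ on ℝ⁴. -/
def omegaSt (u v : R4) : ℝ := u 0 * v 1 - u 1 * v 0 + u 2 * v 3 - u 3 * v 2

/-- The standard Liouville 1-form λ_st(x)(u) = ½ ω_st(x,u). -/
def lambdaSt (x u : R4) : ℝ := (1 / 2) * omegaSt x u

section

open Set Filter Topology MeasureTheory

theorem exists_quadrature_at_one (n : ℕ) {ε : ℝ} (hε : 0 < ε) :
    ∃ (t w : Fin (n + 1) → ℝ), (∀ i, 0 < t i ∧ t i < ε) ∧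
      ∀ p : Polynomial ℝ, p.natDegree ≤ n → p.eval 1 = ∑ i, w i * p.eval (t i) := by
  let t : Fin (n + 1) → ℝ := fun i => ε * ((i : ℝ) + 1) / (n + 2)
  have ht : Set.InjOn t (Finset.univ : Finset (Fin (n + 1))) := by
    intro i _ j _ hij
    have h2 : ((n : ℝ) + 2) ≠ 0 := by positivity
    have : (i : ℝ) = j := by
      simp only [t] at hij
      field_simp at hij
      linarith
    exact Fin.ext (by exact_mod_cast this)
  refine ⟨t, fun i => (Lagrange.basis Finset.univ t i).eval 1, fun i => ⟨by positivity, ?_⟩, ?_⟩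
  · have : (i : ℝ) + 1 ≤ n + 1 := by
      have := i.2
      exact_mod_cast this
    simp only [t]
    rw [div_lt_iff₀ (by positivity)]
    nlinarith
  · intro p hp
    have h := Lagrange.eq_interpolate (f := p) ht (by
      rw [Finset.card_univ, Fintype.card_fin]
      exact lt_of_le_of_lt Polynomial.degree_le_natDegree (by exact_mod_cast Nat.lt_succ_of_le hp))
    conv_lhs => rw [h, Lagrange.interpolate_apply]
    simp [Polynomial.eval_finsetSum, mul_comm]

section Retraction

variable {V : Type*} [NormedAddCommGroup V] [InnerProductSpace ℝ V] [FiniteDimensional ℝ V]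

theorem exists_polynomial_det_one_add_smul (A : V →L[ℝ] V) :
    ∃ p : Polynomial ℝ, p.natDegree ≤ Module.finrank ℝ V ∧
      ∀ t : ℝ, p.eval t = (1 + t • A : V →L[ℝ] V).det := by
  let b := Module.finBasis ℝ V
  let M := LinearMap.toMatrix b b (A : V →ₗ[ℝ] V)
  refine ⟨Matrix.det ((Polynomial.X : Polynomial ℝ) • M.map Polynomial.C
    + (1 : Matrix _ _ ℝ).map Polynomial.C), ?_, fun t => ?_⟩
  · simpa using Polynomial.natDegree_det_X_add_C_le M 1
  · have h1 : (1 + t • A : V →L[ℝ] V).det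
        = LinearMap.det ((1 : V →ₗ[ℝ] V) + t • (A : V →ₗ[ℝ] V)) := rfl
    rw [h1, ← LinearMap.det_toMatrix b, ← Polynomial.coe_evalRingHom, RingHom.map_det]
    congr 1
    ext i j
    simp [M, LinearMap.toMatrix_one, Matrix.one_apply, add_comm]
    split_ifs <;> simp [mul_comm]

theorem det_one_add_smul_pos (A : V →L[ℝ] V) {K t : ℝ} (hA : ‖A‖ ≤ K) (ht : 0 ≤ t)
    (htK : t * K < 1) : 0 < (1 + t • A : V →L[ℝ] V).det := by
  have hne : ∀ s ∈ Icc (0 : ℝ) t, (1 + s • A : V →L[ℝ] V).det ≠ 0 := by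
    intro s hs h0
    have h0' : LinearMap.det ((1 + s • A : V →L[ℝ] V) : V →ₗ[ℝ] V) = 0 := h0
    rw [LinearMap.det_eq_zero_iff_ker_ne_bot, Submodule.ne_bot_iff] at h0'
    obtain ⟨x, hx, hx0⟩ := h0'
    have hx' : x + s • A x = 0 := by simpa using hx
    have h1 : ‖x‖ ≤ s * (K * ‖x‖) := by
      calc ‖x‖ = ‖s • A x‖ := by
            rw [← norm_neg (s • A x), ← eq_neg_of_add_eq_zero_left hx']
        _ = s * ‖A x‖ := by rw [norm_smul, Real.norm_of_nonneg hs.1]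
        _ ≤ s * (K * ‖x‖) := by
          have := A.le_of_opNorm_le hA x
          have := hs.1
          gcongr
    have hxp : 0 < ‖x‖ := norm_pos_iff.2 hx0
    have hK : 0 ≤ K := (norm_nonneg A).trans hA
    have h2 : s * K ≤ t * K := mul_le_mul_of_nonneg_right hs.2 hK
    nlinarith
  obtain ⟨p, -, hp⟩ := exists_polynomial_det_one_add_smul A
  by_contra hcon
  have hmem : (0 : ℝ) ∈ Icc (p.eval t) (p.eval 0) := by
    rw [hp, hp]
    exact ⟨not_lt.1 hcon, by simp [ContinuousLinearMap.det]⟩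
  obtain ⟨s, hs, hs0⟩ := intermediate_value_Icc' ht p.continuous.continuousOn hmem
  exact hne s hs ((hp s).symm.trans hs0)

theorem not_contDiff_retraction {ρ : ℝ} (hρ : 0 < ρ) (r : V → V) (hr : ContDiff ℝ 1 r)
    (hnorm : ∀ x ∈ Metric.closedBall (0 : V) ρ, ‖r x‖ = ρ)
    (hid : ∀ x, ‖x‖ = ρ → r x = x) : False := by
  borelize V
  let μ : Measure V := volume
  let g : V → V := fun x => r x - x
  have hg : ContDiff ℝ 1 g := hr.sub contDiff_id
  have hgd : ∀ x, DifferentiableAt ℝ g x := fun x => hg.differentiable (by simp) x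
  have hgc : Continuous (fderiv ℝ g) := hg.continuous_fderiv (by simp)
  obtain ⟨K, hK⟩ := (isCompact_closedBall (0 : V) ρ).exists_bound_of_continuousOn hgc.continuousOn
  have hK0 : 0 ≤ K := (norm_nonneg _).trans (hK 0 (by simp [hρ.le]))
  have hlip : ∀ x ∈ Metric.closedBall (0 : V) ρ, ∀ y ∈ Metric.closedBall (0 : V) ρ,
      ‖g x - g y‖ ≤ K * ‖x - y‖ := fun x hx y hy =>
    (convex_closedBall (0 : V) ρ).norm_image_sub_le_of_norm_fderiv_le (fun z _ => hgd z) hK hy hx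
  let f : ℝ → V → V := fun t x => x + t • g x
  have hf' : ∀ t x, HasFDerivAt (f t) (1 + t • fderiv ℝ g x : V →L[ℝ] V) x := fun t x =>
    (hasFDerivAt_id x).add ((hgd x).hasFDerivAt.const_smul t)
  have hball : ∀ {x : V}, x ∈ Metric.ball (0 : V) ρ → x ∈ Metric.closedBall (0 : V) ρ :=
    fun hx => Metric.ball_subset_closedBall hx
  have hvol : ∀ t, 0 < t → t < 1 / (K + 1) →
      ∫ x in Metric.ball (0 : V) ρ, (1 + t • fderiv ℝ g x : V →L[ℝ] V).det ∂μ
        = μ.real (Metric.ball (0 : V) ρ) := by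
    intro t ht htK
    have htK' : t * K < 1 := by
      rw [lt_div_iff₀ (by positivity)] at htK
      nlinarith
    have ht1 : t < 1 := htK.trans_le (by rw [div_le_one (by positivity)]; linarith)
    have hinj : InjOn (f t) (Metric.closedBall (0 : V) ρ) := by
      intro x hx y hy hxy
      have h1 : x - y = t • (g y - g x) := by
        have : x + t • g x = y + t • g y := hxy
        rw [smul_sub, sub_eq_sub_iff_add_eq_add, this, add_comm]
      have h2 : ‖x - y‖ ≤ t * (K * ‖x - y‖) := by
        calc ‖x - y‖ = t * ‖g y - g x‖ := by rw [h1, norm_smul, Real.norm_of_nonneg ht.le]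
          _ ≤ t * (K * ‖y - x‖) := by gcongr; exact hlip y hy x hx
          _ = _ := by rw [norm_sub_rev]
      have h3 : ‖x - y‖ = 0 := by
        by_contra hne
        have : 0 < ‖x - y‖ := lt_of_le_of_ne (norm_nonneg _) (Ne.symm hne)
        nlinarith
      exact sub_eq_zero.1 (norm_eq_zero.1 h3)
    have hpos : ∀ x ∈ Metric.closedBall (0 : V) ρ, 0 < (1 + t • fderiv ℝ g x : V →L[ℝ] V).det :=
      fun x hx => det_one_add_smul_pos _ (hK x hx) ht.le htK'
    have hmaps : ∀ x ∈ Metric.ball (0 : V) ρ, f t x ∈ Metric.ball (0 : V) ρ := by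
      intro x hx
      have h1 := hnorm x (hball hx)
      rw [mem_ball_zero_iff] at hx ⊢
      have h2 : f t x = (1 - t) • x + t • r x := by
        simp only [f, g, smul_sub, sub_smul, one_smul]; abel
      calc ‖f t x‖ ≤ (1 - t) * ‖x‖ + t * ‖r x‖ := by
            rw [h2]
            refine (norm_add_le _ _).trans ?_
            rw [norm_smul, norm_smul, Real.norm_of_nonneg ht.le,
              Real.norm_of_nonneg (by linarith)]
        _ < ρ := by rw [h1]; nlinarith
    have hopen : IsOpen (f t '' Metric.ball (0 : V) ρ) := by
      rw [isOpen_iff_mem_nhds]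
      rintro _ ⟨x, hx, rfl⟩
      have hs : HasStrictFDerivAt (f t) (1 + t • fderiv ℝ g x : V →L[ℝ] V) x := by
        refine ContDiffAt.hasStrictFDerivAt' (n := 1) ?_ (hf' t x) (by simp)
        exact (contDiff_id.add (contDiff_const.smul hg)).contDiffAt
      have hsurj : (1 + t • fderiv ℝ g x : V →L[ℝ] V).range = ⊤ := by
        have h1 : IsUnit ((1 + t • fderiv ℝ g x : V →L[ℝ] V) : V →ₗ[ℝ] V) := by
          rw [LinearMap.isUnit_iff_isUnit_det]
          exact (hpos x (hball hx)).ne'.isUnit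
        exact (LinearMap.isUnit_iff_range_eq_top _).1 h1
      rw [← hs.map_nhds_eq_of_surj hsurj]
      exact image_mem_map (Metric.isOpen_ball.mem_nhds hx)
    have himage : f t '' Metric.ball (0 : V) ρ = Metric.ball (0 : V) ρ := by
      refine Subset.antisymm (image_subset_iff.2 hmaps) ?_
      refine (convex_ball (0 : V) ρ).isPreconnected.subset_of_closure_inter_subset hopen
        ⟨f t 0, hmaps 0 (by simpa using hρ), mem_image_of_mem _ (by simpa using hρ)⟩ ?_
      rintro y ⟨hy, hyb⟩
      have hcomp : IsCompact (f t '' Metric.closedBall (0 : V) ρ) :=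
        (isCompact_closedBall _ _).image (continuous_id.add (continuous_const.smul hg.continuous))
      obtain ⟨x, hx, rfl⟩ := closure_minimal
        (image_mono Metric.ball_subset_closedBall) hcomp.isClosed hy
      refine ⟨x, ?_, rfl⟩
      rw [mem_closedBall_zero_iff] at hx
      rw [mem_ball_zero_iff]
      refine lt_of_le_of_ne hx fun hxe => ?_
      have : f t x = x := by simp [f, g, hid x hxe]
      rw [this, mem_ball_zero_iff, hxe] at hyb
      exact lt_irrefl _ hyb
    have hcv := integral_image_eq_integral_abs_det_fderiv_smul μ (s := Metric.ball (0 : V) ρ)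
      measurableSet_ball (fun x _ => (hf' t x).hasFDerivWithinAt)
      (hinj.mono Metric.ball_subset_closedBall) (fun _ => (1 : ℝ))
    rw [himage] at hcv
    simp only [smul_eq_mul, mul_one, setIntegral_const] at hcv
    rw [hcv]
    exact setIntegral_congr_fun measurableSet_ball fun x hx => (abs_of_pos (hpos x (hball hx))).symm
  obtain ⟨t, w, ht, hw⟩ := exists_quadrature_at_one (Module.finrank ℝ V)
    (ε := 1 / (K + 1)) (by positivity)
  have hsum : ∑ i, w i = 1 := by simpa using (hw 1 (by simp)).symm
  have hdet : ∀ x, (1 + (1 : ℝ) • fderiv ℝ g x : V →L[ℝ] V).det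
      = ∑ i, w i * (1 + t i • fderiv ℝ g x : V →L[ℝ] V).det := by
    intro x
    obtain ⟨p, hp, hp'⟩ := exists_polynomial_det_one_add_smul (fderiv ℝ g x)
    simp only [← hp']
    exact hw p hp
  have hzero : ∀ x ∈ Metric.ball (0 : V) ρ, (1 + (1 : ℝ) • fderiv ℝ g x : V →L[ℝ] V).det = 0 := by
    intro x hx
    have hrx : HasFDerivAt r (1 + (1 : ℝ) • fderiv ℝ g x : V →L[ℝ] V) x := by
      have : f 1 = r := by ext y; simp [f, g]
      rw [← this]; exact hf' 1 x
    have hconst : (fun y => ‖r y‖ ^ 2) =ᶠ[𝓝 x] fun _ => ρ ^ 2 := by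
      filter_upwards [Metric.isOpen_ball.mem_nhds hx] with y hy
      rw [hnorm y (hball hy)]
    have h2 := (hrx.norm_sq).unique ((hasFDerivAt_const (ρ ^ 2) x).congr_of_eventuallyEq hconst)
    generalize (1 + (1 : ℝ) • fderiv ℝ g x : V →L[ℝ] V) = L at h2 ⊢
    by_contra hne
    have h1 : IsUnit (L : V →ₗ[ℝ] V) := by
      rw [LinearMap.isUnit_iff_isUnit_det]
      exact IsUnit.mk0 _ hne
    obtain ⟨v, hv⟩ := LinearMap.range_eq_top.1 ((LinearMap.isUnit_iff_range_eq_top _).1 h1) (r x)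
    have h3 := congrArg (fun L : V →L[ℝ] ℝ => L v) h2
    have hv' : L v = r x := hv
    have h4 : 2 * ⟪r x, r x⟫ = 0 := by simpa [hv'] using h3
    rw [real_inner_self_eq_norm_sq, hnorm x (hball hx)] at h4
    nlinarith [sq_nonneg ρ, pow_pos hρ 2]
  have hdetint : ∀ s : ℝ, IntegrableOn (fun x => (1 + s • fderiv ℝ g x : V →L[ℝ] V).det)
      (Metric.ball (0 : V) ρ) μ := by
    intro s
    refine IntegrableOn.mono_set ?_ Metric.ball_subset_closedBall
    refine ContinuousOn.integrableOn_compact (isCompact_closedBall _ _) ?_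
    exact (ContinuousLinearMap.continuous_det.comp
      (continuous_const.add (hgc.const_smul s))).continuousOn
  have hfin : (0 : ℝ) = μ.real (Metric.ball (0 : V) ρ) := by
    calc (0 : ℝ)
        = ∫ x in Metric.ball (0 : V) ρ, (1 + (1 : ℝ) • fderiv ℝ g x : V →L[ℝ] V).det ∂μ := by
          rw [setIntegral_congr_fun measurableSet_ball hzero]; simp
      _ = ∫ x in Metric.ball (0 : V) ρ, ∑ i, w i * (1 + t i • fderiv ℝ g x : V →L[ℝ] V).det ∂μ := by
          simp only [hdet]
      _ = ∑ i, w i * μ.real (Metric.ball (0 : V) ρ) := by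
          rw [integral_finsetSum _ fun i _ => (hdetint (t i)).const_mul (w i)]
          refine Finset.sum_congr rfl fun i _ => ?_
          rw [integral_const_mul, hvol (t i) (ht i).1 (ht i).2]
      _ = _ := by rw [← Finset.sum_mul, hsum, one_mul]
  have hposv : 0 < μ.real (Metric.ball (0 : V) ρ) :=
    ENNReal.toReal_pos (Metric.measure_ball_pos μ 0 hρ).ne' measure_ball_lt_top.ne
  exact hposv.ne hfin

theorem exists_zero_of_eq_id_on_sphere (q : V → V)
    (hq : ContinuousOn q (Metric.closedBall (0 : V) 1)) (hid : ∀ x, ‖x‖ = 1 → q x = x) :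
    ∃ x ∈ Metric.closedBall (0 : V) 1, q x = 0 := by
  by_contra! hne
  classical
  let Q : V → V := fun x => if ‖x‖ ≤ 1 then q x else x
  have hset : {x : V | ‖x‖ ≤ 1} = Metric.closedBall (0 : V) 1 := by ext; simp
  have hQ : Continuous Q := by
    refine continuous_if ?_ ?_ continuousOn_id
    · intro x hx
      rw [hset] at hx
      have := Metric.frontier_closedBall_subset_sphere hx
      exact hid x (by simpa using this)
    · rw [hset, Metric.isClosed_closedBall.closure_eq]; exact hq
  have hQne : ∀ x, Q x ≠ 0 := by
    intro x
    by_cases hx : ‖x‖ ≤ 1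
    · simpa [Q, hx] using hne x (by simpa using hx)
    · simp only [Q, hx, if_false]
      intro h0
      simp [h0] at hx
  have hS : IsClosed {x : V | 2 ≤ ‖x‖} := isClosed_le continuous_const continuous_norm
  have hU : IsOpen {x : V | 1 < ‖x‖} := isOpen_lt continuous_const continuous_norm
  obtain ⟨p, hp, hpQ, hpS, -⟩ := hQ.exists_contDiff_approx_and_eqOn 1 hQ.norm
    (fun x => norm_pos_iff.2 (hQne x)) hS
    (hU.mem_nhdsSet.2 fun x (hx : 2 ≤ ‖x‖) => show 1 < ‖x‖ by linarith)
    (contDiffOn_id.congr fun x (hx : 1 < ‖x‖) => by simp [Q, not_le.2 hx])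
  have hpne : ∀ x, p x ≠ 0 := by
    intro x h0
    have := hpQ x
    rw [h0, dist_zero_left] at this
    exact lt_irrefl _ this
  refine not_contDiff_retraction (V := V) two_pos (fun x => (2 * ‖p x‖⁻¹) • p x) ?_ ?_ ?_
  · have hp' : ContDiff ℝ 1 p := hp
    exact (contDiff_const.mul
      ((hp'.norm ℝ hpne).inv fun x => (norm_pos_iff.2 (hpne x)).ne')).smul hp'
  · intro x _
    have := norm_pos_iff.2 (hpne x)
    simp only [norm_smul, norm_mul, norm_inv, norm_norm]
    field_simp
    norm_num
  · intro x hx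
    have : p x = x := by
      rw [hpS (show 2 ≤ ‖x‖ from hx.ge)]
      simp [Q, hx]
    simp [this, hx]

end Retraction

section Linking

variable {E : Type*} [NormedAddCommGroup E] [InnerProductSpace ℝ E]

/-- The generalized Rayleigh quotient of the quadratic form of `L` with respect to `F`. -/
def rayleigh (L : E →L[ℝ] E) (F : E → ℝ) (x : E) : ℝ := ⟪L x, x⟫ / (2 * F x)

/-- Up to the positive factor `F x`, the gradient of `rayleigh L F` at `x`. -/
def rayleighDir (L : E →L[ℝ] E) (F : E → ℝ) (G : E → E) (x : E) : E :=
  L x - rayleigh L F x • G x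

variable {L : E →L[ℝ] E} {F : E → ℝ} {G : E → E}

theorem rayleigh_smul (hhom : ∀ x (s : ℝ), 0 < s → F (s • x) = s ^ 2 * F x) {s : ℝ} (hs : 0 < s)
    (x : E) : rayleigh L F (s • x) = rayleigh L F x := by
  simp only [rayleigh, map_smul, inner_smul_left, inner_smul_right, hhom x s hs,
    conj_trivial]
  rw [show s * (s * ⟪L x, x⟫) = s ^ 2 * ⟪L x, x⟫ by ring,
    show 2 * (s ^ 2 * F x) = s ^ 2 * (2 * F x) by ring]
  exact mul_div_mul_left _ _ (pow_ne_zero 2 hs.ne')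

theorem inner_rayleighDir (hpos : ∀ x, x ≠ 0 → 0 < F x) (heuler : ∀ x, ⟪G x, x⟫ = 2 * F x)
    {x : E} (hx : x ≠ 0) : ⟪rayleighDir L F G x, x⟫ = 0 := by
  have := hpos x hx
  simp only [rayleighDir, inner_sub_left, inner_smul_left, heuler, rayleigh, conj_trivial]
  field_simp
  ring

theorem hasFDerivAt_rayleigh (hL : ∀ x y, ⟪L x, y⟫ = ⟪x, L y⟫)
    (hF : ∀ x, HasFDerivAt F (innerSL ℝ (G x)) x) (hpos : ∀ x, x ≠ 0 → 0 < F x)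
    {x : E} (hx : x ≠ 0) :
    HasFDerivAt (rayleigh L F) ((F x)⁻¹ • innerSL ℝ (rayleighDir L F G x)) x := by
  have hFx := hpos x hx
  have h1 : HasFDerivAt (fun y => ⟪L y, y⟫) (2 • innerSL ℝ (L x)) x := by
    refine (L.hasFDerivAt.inner ℝ (hasFDerivAt_id x)).congr_fderiv ?_
    ext v
    simp [fderivInnerCLM_apply, hL v x, real_inner_comm, two_mul]
  have h2 := h1.mul ((hasDerivAt_inv (mul_pos two_pos hFx).ne').comp_hasFDerivAt x
    ((hF x).const_mul 2))
  refine (h2.congr_fderiv ?_ : HasFDerivAt (fun y => ⟪L y, y⟫ * (2 * F y)⁻¹) _ x)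
  ext v
  simp [rayleighDir, rayleigh]
  field_simp
  ring

theorem continuousAt_rayleigh (hF : ∀ x, HasFDerivAt F (innerSL ℝ (G x)) x)
    (hpos : ∀ x, x ≠ 0 → 0 < F x) {x : E} (hx : x ≠ 0) : ContinuousAt (rayleigh L F) x := by
  have h1 : ContinuousAt F x := (hF x).continuousAt
  exact ((L.continuous.inner continuous_id).continuousAt).div (continuousAt_const.mul h1)
    (mul_pos two_pos (hpos x hx)).ne'

theorem continuousAt_rayleighDir (hF : ∀ x, HasFDerivAt F (innerSL ℝ (G x)) x) (hG : Continuous G)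
    (hpos : ∀ x, x ≠ 0 → 0 < F x) {x : E} (hx : x ≠ 0) :
    ContinuousAt (rayleighDir L F G) x :=
  L.continuous.continuousAt.sub ((continuousAt_rayleigh hF hpos hx).smul hG.continuousAt)

theorem norm_le_norm_sub_smul_of_inner_eq_zero {x w : E} (h : ⟪w, x⟫ = 0) (s : ℝ) :
    ‖x‖ ≤ ‖x - s • w‖ := by
  have h1 : ‖x - s • w‖ ^ 2 = ‖x‖ ^ 2 + ‖s • w‖ ^ 2 := by
    rw [norm_sub_sq_real, inner_smul_right, real_inner_comm, h]; ring
  exact le_of_sq_le_sq (by nlinarith [sq_nonneg ‖s • w‖]) (norm_nonneg _)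

theorem exists_uniform_descent (hL : ∀ x y, ⟪L x, y⟫ = ⟪x, L y⟫)
    (hF : ∀ x, HasFDerivAt F (innerSL ℝ (G x)) x) (hG : Continuous G)
    (hpos : ∀ x, x ≠ 0 → 0 < F x) (heuler : ∀ x, ⟪G x, x⟫ = 2 * F x)
    {K : Set E} (hK : IsCompact K) (hK0 : ∀ x ∈ K, x ≠ 0)
    (hKw : ∀ x ∈ K, rayleighDir L F G x ≠ 0) :
    ∃ s₀ > 0, ∃ η > 0, ∀ x ∈ K, ∀ s ∈ Icc (0 : ℝ) s₀,
      rayleigh L F (x - s • rayleighDir L F G x) ≤ rayleigh L F x - η * s := by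
  let w := rayleighDir L F G
  let D : ℝ × E → ℝ := fun z => (F (z.2 - z.1 • w z.2))⁻¹ * ⟪w (z.2 - z.1 • w z.2), w z.2⟫
  have hwc : ∀ x, x ≠ 0 → ContinuousAt w x := fun x hx => continuousAt_rayleighDir hF hG hpos hx
  have hDc : ∀ x, x ≠ 0 → ContinuousAt D (0, x) := by
    intro x hx
    have hw2 : ContinuousAt (fun z : ℝ × E => w z.2) (0, x) :=
      ContinuousAt.comp (g := w) (f := fun z : ℝ × E => z.2) (x := ((0 : ℝ), x)) (hwc x hx)
        continuousAt_snd
    have hy : ContinuousAt (fun z : ℝ × E => z.2 - z.1 • w z.2) (0, x) :=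
      continuousAt_snd.sub (continuousAt_fst.smul hw2)
    have hwy : ContinuousAt (fun z : ℝ × E => w (z.2 - z.1 • w z.2)) (0, x) :=
      ContinuousAt.comp (g := w) (f := fun z : ℝ × E => z.2 - z.1 • w z.2) (x := ((0 : ℝ), x))
        (by simpa using hwc x hx) hy
    have hFy : ContinuousAt (fun z : ℝ × E => F (z.2 - z.1 • w z.2)) (0, x) :=
      ContinuousAt.comp (g := F) (f := fun z : ℝ × E => z.2 - z.1 • w z.2) (x := ((0 : ℝ), x))
        (by simpa using (hF x).continuousAt) hy
    exact (hFy.inv₀ (by simpa using (hpos x hx).ne')).mul (hwy.inner hw2)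
  obtain ⟨η, hη, hηK⟩ := hK.exists_forall_le' (f := fun x => D (0, x)) (a := 0)
    (fun x hx => ((hDc x (hK0 x hx)).comp (f := fun x => ((0 : ℝ), x))
      (by fun_prop)).continuousWithinAt)
    (fun x hx => by
      have h1 := hpos x (hK0 x hx)
      have h2 := norm_pos_iff.2 (hKw x hx)
      simp only [D, zero_smul, sub_zero, real_inner_self_eq_norm_sq]
      positivity)
  have hev : ∀ᶠ s in 𝓝 (0 : ℝ), ∀ x ∈ K, η / 2 < D (s, x) := by
    refine hK.eventually_forall_of_forall_eventually fun x hx => ?_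
    exact (hDc x (hK0 x hx)).eventually_const_lt ((half_lt_self hη).trans_le (hηK x hx))
  obtain ⟨δ, hδ, hδ'⟩ := Metric.eventually_nhds_iff.1 hev
  refine ⟨δ / 2, half_pos hδ, η / 2, half_pos hη, fun x hx s hs => ?_⟩
  have hw0 : ⟪w x, x⟫ = 0 := inner_rayleighDir hpos heuler (hK0 x hx)
  have hy0 : ∀ s : ℝ, x - s • w x ≠ 0 := fun s =>
    norm_pos_iff.1 ((norm_pos_iff.2 (hK0 x hx)).trans_le
      (norm_le_norm_sub_smul_of_inner_eq_zero hw0 s))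
  have hder : ∀ s : ℝ, HasDerivAt (fun s => rayleigh L F (x - s • w x)) (-D (s, x)) s := by
    intro s
    have h1 : HasDerivAt (fun s : ℝ => x - s • w x) (-(w x)) s := by
      simpa using ((hasDerivAt_id s).smul_const (w x)).const_sub x
    have h2 := (hasFDerivAt_rayleigh hL hF hpos (hy0 s)).comp_hasDerivAt s h1
    refine h2.congr_deriv ?_
    simp [D, w]
  have hmvt := (convex_Icc (0 : ℝ) (δ / 2)).image_sub_le_mul_sub_of_deriv_le
    (f := fun s => rayleigh L F (x - s • w x)) (C := -(η / 2))
    (fun s _ => (hder s).continuousAt.continuousWithinAt)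
    (fun s _ => (hder s).differentiableAt.differentiableWithinAt)
    (fun s hs => by
      rw [interior_Icc] at hs
      rw [(hder s).deriv]
      have := hδ' (y := s)
        (by rw [dist_zero_right, Real.norm_of_nonneg hs.1.le]; linarith [hs.2]) x hx
      linarith)
    0 ⟨le_rfl, (half_pos hδ).le⟩ s hs hs.1
  simp only [zero_smul, sub_zero] at hmvt
  linarith

theorem exists_critical_point_of_linking [FiniteDimensional ℝ E]
    (hL : ∀ x y, ⟪L x, y⟫ = ⟪x, L y⟫)
    (hF : ∀ x, HasFDerivAt F (innerSL ℝ (G x)) x) (hG : Continuous G)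
    (heuler : ∀ x, ⟪G x, x⟫ = 2 * F x) (hhom : ∀ x (s : ℝ), 0 < s → F (s • x) = s ^ 2 * F x)
    {c C : ℝ} (hc : 0 < c) (hcF : ∀ x, c * ‖x‖ ^ 2 ≤ F x) (hFC : ∀ x, F x ≤ C * ‖x‖ ^ 2)
    {V : Submodule ℝ E} {μ ν : ℝ} (hμ : 0 < μ) (hν : 0 < ν)
    (hV : ∀ v ∈ V, ⟪L v, v⟫ ≤ 0) (hW : ∀ v ∈ Vᗮ, μ * ‖v‖ ^ 2 ≤ ⟪L v, v⟫)
    {e : E} (heV : e ∈ Vᗮ) (he : ‖e‖ = 1) (hLe : L e = ν • e) :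
    ∃ x : E, x ≠ 0 ∧ ∃ b : ℝ, μ / (8 * C) ≤ b ∧ b ≤ ν / (2 * c) ∧ L x = b • G x := by
  have hpos : ∀ x, x ≠ 0 → 0 < F x := fun x hx =>
    (mul_pos hc (pow_pos (norm_pos_iff.2 hx) 2)).trans_le (hcF x)
  have hC : 0 < C := by
    have h1 := hcF e
    have h2 := hFC e
    rw [he] at h1 h2
    linarith
  by_contra! hcon
  set R := rayleigh L F with hR
  set w := rayleighDir L F G with hw
  let S : Set E := Metric.sphere (0 : E) 1
  have hS0 : ∀ x ∈ S, x ≠ 0 := fun x hx h0 => by simp [S, h0] at hx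
  let α := μ / (2 * C)
  let β := ν / (2 * c)
  have hα : 0 < α := by positivity
  have hα4 : μ / (8 * C) = α / 4 := by simp only [α]; field_simp; norm_num
  have hRc : ContinuousOn R S := fun x hx =>
    (continuousAt_rayleigh hF hpos (hS0 x hx)).continuousWithinAt
  have hwc : ContinuousOn w S := fun x hx =>
    (continuousAt_rayleighDir hF hG hpos (hS0 x hx)).continuousWithinAt
  let K : Set E := S ∩ R ⁻¹' Icc (α / 4) β
  have hK : IsCompact K := (isCompact_sphere (0 : E) 1).of_isClosed_subset
    (hRc.preimage_isClosed_of_isClosed Metric.isClosed_sphere isClosed_Icc) inter_subset_left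
  obtain ⟨s₀, hs₀, η, hη, hdesc⟩ := exists_uniform_descent hL hF hG hpos heuler hK
    (fun x hx => hS0 x hx.1) (fun x hx h0 => hcon x (hS0 x hx.1) (R x) (hα4 ▸ hx.2.1) hx.2.2
      (sub_eq_zero.1 h0))
  let χ : ℝ → ℝ := fun r => max 0 (min 1 (4 * r / α - 1))
  have hχ0 : ∀ r, 0 ≤ χ r := fun r => le_max_left _ _
  have hχ1 : ∀ r, χ r ≤ 1 := fun r => max_le zero_le_one (min_le_left _ _)
  have hχlow : ∀ r, r ≤ α / 4 → χ r = 0 := by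
    intro r hr
    refine max_eq_left ((min_le_right _ _).trans ?_)
    rw [sub_nonpos, div_le_one hα]; linarith
  have hχhigh : ∀ r, α / 2 ≤ r → χ r = 1 := by
    intro r hr
    have : (1 : ℝ) ≤ 4 * r / α - 1 := by
      rw [le_sub_iff_add_le, le_div_iff₀ hα]; linarith
    simp [χ, min_eq_left this]
  let Y : E → E := fun x => x - (s₀ * χ (R x)) • w x
  let N : E → E := fun x => ‖Y x‖⁻¹ • Y x
  have hY0 : ∀ x ∈ S, Y x ≠ 0 := fun x hx =>
    norm_pos_iff.1 ((norm_pos_iff.2 (hS0 x hx)).trans_le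
      (norm_le_norm_sub_smul_of_inner_eq_zero (inner_rayleighDir hpos heuler (hS0 x hx)) _))
  have hNS : MapsTo N S S := by
    intro x hx
    have := norm_pos_iff.2 (hY0 x hx)
    simp only [S, mem_sphere_zero_iff_norm, N, norm_smul, norm_inv, norm_norm]
    field_simp
  have hRN : ∀ x ∈ S, R (N x) = R (Y x) := fun x hx =>
    rayleigh_smul hhom (inv_pos.2 (norm_pos_iff.2 (hY0 x hx))) _
  have hNid : ∀ x ∈ S, R x ≤ α / 4 → N x = x := by
    intro x hx hxR
    have hx1 : ‖x‖ = 1 := by simpa [S] using hx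
    simp [N, Y, hχlow _ hxR, hx1]
  have hNdesc : ∀ x ∈ S, α / 4 ≤ R x → R x ≤ β → R (N x) ≤ R x - η * (s₀ * χ (R x)) := by
    intro x hx h1 h2
    rw [hRN x hx]
    exact hdesc x ⟨hx, h1, h2⟩ _ ⟨mul_nonneg hs₀.le (hχ0 _), mul_le_of_le_one_right hs₀.le (hχ1 _)⟩
  have hNle : ∀ x ∈ S, R x ≤ β → R (N x) ≤ R x := by
    intro x hx h2
    rcases le_total (R x) (α / 4) with h1 | h1
    · rw [hNid x hx h1]
    · have := hNdesc x hx h1 h2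
      have := mul_nonneg hη.le (mul_nonneg hs₀.le (hχ0 (R x)))
      linarith
  have hχc : Continuous χ := by fun_prop
  have hNc : ContinuousOn N S := by
    have hYc : ContinuousOn Y S := continuousOn_id.sub
      ((continuousOn_const.mul (hχc.comp_continuousOn hRc)).smul hwc)
    exact (hYc.norm.inv₀ fun x hx => (norm_pos_iff.2 (hY0 x hx)).ne').smul hYc
  have hiter : ∀ k : ℕ, ∀ x ∈ S, R x ≤ β →
      R (N^[k] x) ≤ β ∧ R (N^[k] x) ≤ max (α / 2) (β - k * (η * s₀)) := by
    intro k x hx hxR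
    induction k with
    | zero => simpa using ⟨hxR, Or.inr hxR⟩
    | succ k ih =>
      have hkS : N^[k] x ∈ S := hNS.iterate k hx
      rw [Function.iterate_succ_apply']
      have h1 := hNle _ hkS ih.1
      refine ⟨h1.trans ih.1, ?_⟩
      rcases le_total (R (N^[k] x)) (α / 2) with h2 | h2
      · exact (h1.trans h2).trans (le_max_left _ _)
      · have h3 := hNdesc _ hkS (by linarith) ih.1
        rw [hχhigh _ h2, mul_one] at h3
        have hp : 0 < η * s₀ := mul_pos hη hs₀
        rcases le_max_iff.1 ih.2 with h4 | h4
        · exact le_max_of_le_left (by linarith)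
        · refine le_max_of_le_right ?_
          push_cast
          linarith
  obtain ⟨k, hk⟩ := exists_nat_gt ((β - α / 2) / (η * s₀))
  have hk' : β - k * (η * s₀) ≤ α / 2 := by
    rw [div_lt_iff₀ (mul_pos hη hs₀)] at hk
    linarith
  let σ : V → E := fun v => (v : E) + √(1 - ‖v‖ ^ 2) • e
  have hσc : Continuous σ := by fun_prop
  have hve : ∀ v : V, ⟪(v : E), e⟫ = 0 := fun v => heV v v.2
  have hσn : ∀ v ∈ Metric.closedBall (0 : V) 1, ‖σ v‖ = 1 ∧ R (σ v) ≤ β := by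
    intro v hv
    have hv1 : ‖v‖ ≤ 1 := by simpa using hv
    have hs : √(1 - ‖v‖ ^ 2) ^ 2 = 1 - ‖v‖ ^ 2 :=
      Real.sq_sqrt (by nlinarith [norm_nonneg v])
    have h1 : ‖σ v‖ ^ 2 = 1 := by
      simp only [σ]
      rw [norm_add_sq_real, inner_smul_right, hve, norm_smul, he, mul_pow, Real.norm_eq_abs,
        sq_abs, hs]
      simp
    have h1' : ‖σ v‖ = 1 := by nlinarith [norm_nonneg (σ v)]
    refine ⟨h1', ?_⟩
    have hve' : ⟪e, (v : E)⟫ = 0 := by rw [real_inner_comm]; exact hve v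
    have hA : ⟪L (σ v), σ v⟫ = ⟪L v, (v : E)⟫ + √(1 - ‖v‖ ^ 2) ^ 2 * ν := by
      have h3 : ⟪L v, e⟫ = 0 := by rw [hL, hLe, inner_smul_right, hve, mul_zero]
      simp only [σ, map_add, map_smul, hLe, inner_add_left, inner_add_right, inner_smul_left,
        inner_smul_right, h3, hve', real_inner_self_eq_norm_sq, he, conj_trivial]
      ring
    have hA' : ⟪L (σ v), σ v⟫ ≤ ν := by
      rw [hA, hs]
      nlinarith [hV v v.2, sq_nonneg ‖v‖]
    have hFσ : c ≤ F (σ v) := by simpa [h1'] using hcF (σ v)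
    simp only [hR, rayleigh, β]
    have : 0 < F (σ v) := hc.trans_le hFσ
    rw [div_le_div_iff₀ (by positivity) (by positivity)]
    nlinarith
  have hσS : MapsTo σ (Metric.closedBall (0 : V) 1) S := fun v hv => by
    simpa [S] using (hσn v hv).1
  obtain ⟨v, hv, hv0⟩ := exists_zero_of_eq_id_on_sphere
    (fun v : V => V.orthogonalProjectionOnto (N^[k] (σ v)))
    (V.orthogonalProjectionOnto.continuous.comp_continuousOn
      ((hNc.iterate hNS k).comp hσc.continuousOn hσS)) (by
      intro v hv
      have hσv : σ v = v := by simp [σ, show ‖(v : E)‖ = 1 from hv]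
      have hfix : N (v : E) = v := by
        refine hNid _ (by simpa [S] using hv) ?_
        have h1 : R v ≤ 0 := by
          refine div_nonpos_of_nonpos_of_nonneg (hV v v.2) ?_
          have := hcF v
          have : 0 ≤ c * ‖(v : E)‖ ^ 2 := by positivity
          linarith
        linarith
      simp only [hσv, Function.iterate_fixed hfix]
      simp)
  have hσv := hσn v hv
  have hzS : N^[k] (σ v) ∈ S := hNS.iterate k (hσS hv)
  have h1 := (hiter k _ (hσS hv) hσv.2).2
  rw [max_eq_left hk'] at h1
  have hzW : N^[k] (σ v) ∈ Vᗮ := Submodule.orthogonalProjectionOnto_eq_zero_iff.1 hv0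
  have h2 := hW _ hzW
  have hz1 : ‖N^[k] (σ v)‖ = 1 := by simpa [S] using hzS
  have h3 := hFC (N^[k] (σ v))
  have h4 := hpos _ (hS0 _ hzS)
  rw [hz1] at h2 h3
  have h5 : α ≤ R (N^[k] (σ v)) := by
    simp only [hR, rayleigh, α]
    rw [div_le_div_iff₀ (by positivity) (by positivity)]
    nlinarith
  linarith

end Linking

theorem exists_spectral_splitting {E : Type*} [NormedAddCommGroup E] [InnerProductSpace ℝ E]
    [FiniteDimensional ℝ E] {L : E →ₗ[ℝ] E} (hL : L.IsSymmetric) {μ : ℝ}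
    (hpos : ∀ (r : ℝ) (x : E), 0 < r → x ≠ 0 → L x = r • x → μ ≤ r) :
    ∃ V : Submodule ℝ E, (∀ v ∈ V, ⟪L v, v⟫ ≤ 0) ∧ (∀ v ∈ Vᗮ, μ * ‖v‖ ^ 2 ≤ ⟪L v, v⟫) ∧
      ∀ (r : ℝ) (x : E), 0 < r → L x = r • x → x ∈ Vᗮ := by
  let b := hL.eigenvectorBasis rfl
  let l := hL.eigenvalues rfl
  have hb : ∀ i, L (b i) = l i • b i := fun i => hL.apply_eigenvectorBasis rfl i
  have hq : ∀ v, ⟪L v, v⟫ = ∑ i, l i * ⟪b i, v⟫ ^ 2 := by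
    intro v
    rw [← b.sum_inner_mul_inner]
    refine Finset.sum_congr rfl fun i _ => ?_
    rw [hL, hb, inner_smul_right, real_inner_comm]
    ring
  have hn : ∀ v, ‖v‖ ^ 2 = ∑ i, ⟪b i, v⟫ ^ 2 := fun v => by
    rw [← real_inner_self_eq_norm_sq, ← b.sum_inner_mul_inner]
    refine Finset.sum_congr rfl fun i _ => ?_
    rw [real_inner_comm]
    ring
  let V : Submodule ℝ E := Submodule.span ℝ (b '' {i | l i ≤ 0})
  have hVo : ∀ v ∈ V, ∀ i, 0 < l i → ⟪b i, v⟫ = 0 := by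
    intro v hv i hi
    refine Submodule.span_induction ?_ (by simp) (fun x y _ _ hx hy => ?_)
      (fun a x _ hx => ?_) hv
    · rintro _ ⟨j, hj, rfl⟩
      refine b.orthonormal.2 ?_
      rintro rfl
      exact absurd hi (not_lt.2 hj)
    · rw [inner_add_right, hx, hy, add_zero]
    · rw [inner_smul_right, hx, mul_zero]
  refine ⟨V, fun v hv => ?_, fun v hv => ?_, fun r x hr hx => ?_⟩
  · rw [hq]
    refine Finset.sum_nonpos fun i _ => ?_
    rcases le_or_gt (l i) 0 with h | h
    · exact mul_nonpos_of_nonpos_of_nonneg h (sq_nonneg _)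
    · simp [hVo v hv i h]
  · rw [hq, hn, Finset.mul_sum]
    refine Finset.sum_le_sum fun i _ => ?_
    rcases le_or_gt (l i) 0 with h | h
    · have : ⟪b i, v⟫ = 0 := hv _ (Submodule.subset_span ⟨i, h, rfl⟩)
      simp [this]
    · exact mul_le_mul_of_nonneg_right (hpos _ (b i) h (b.orthonormal.ne_zero i) (hb i))
        (sq_nonneg _)
  · rw [Submodule.mem_orthogonal]
    intro v hv
    refine Submodule.span_induction ?_ (by simp) (fun x y _ _ hx hy => ?_)
      (fun a x _ hx => ?_) hv
    · rintro _ ⟨j, hj, rfl⟩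
      have h1 : ⟪L (b j), x⟫ = ⟪b j, L x⟫ := hL _ _
      rw [hb, hx, inner_smul_left, inner_smul_right, conj_trivial] at h1
      have h2 : (r - l j) * ⟪b j, x⟫ = 0 := by linarith
      have hj' : l j ≤ 0 := hj
      exact (mul_eq_zero.1 h2).resolve_left (by linarith)
    · rw [inner_add_left, hx, hy, add_zero]
    · rw [inner_smul_left, hx, mul_zero]

theorem exists_critical_point {E : Type*} [NormedAddCommGroup E] [InnerProductSpace ℝ E]
    [FiniteDimensional ℝ E] {L : E →ₗ[ℝ] E} (hL : L.IsSymmetric) {F : E → ℝ} {G : E → E}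
    (hF : ∀ x, HasFDerivAt F (innerSL ℝ (G x)) x) (hG : Continuous G)
    (heuler : ∀ x, ⟪G x, x⟫ = 2 * F x) (hhom : ∀ x (s : ℝ), 0 < s → F (s • x) = s ^ 2 * F x)
    {c C : ℝ} (hc : 0 < c) (hcF : ∀ x, c * ‖x‖ ^ 2 ≤ F x) (hFC : ∀ x, F x ≤ C * ‖x‖ ^ 2)
    {μ ν : ℝ} (hμ : 0 < μ) (hν : 0 < ν)
    (hpos : ∀ (r : ℝ) (x : E), 0 < r → x ≠ 0 → L x = r • x → μ ≤ r)
    {e : E} (he : ‖e‖ = 1) (hLe : L e = ν • e) :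
    ∃ x : E, x ≠ 0 ∧ ∃ b : ℝ, μ / (8 * C) ≤ b ∧ b ≤ ν / (2 * c) ∧ L x = b • G x := by
  obtain ⟨V, hV, hW, hVe⟩ := exists_spectral_splitting hL hpos
  exact exists_critical_point_of_linking (L := LinearMap.toContinuousLinearMap L) hL hF hG heuler
    hhom hc hcF hFC hμ hν hV hW (hVe ν e hν hLe) he hLe

section DiscreteAction

variable {n : ℕ} [NeZero n]

theorem ZMod.abs_le_of_sum_eq_zero {u : ZMod n → ℝ} (hu : ∑ j, u j = 0) {δ : ℝ}
    (hδ : ∀ j, |u (j + 1) - u j| ≤ δ) (j : ZMod n) : |u j| ≤ n * δ := by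
  have hδ0 : 0 ≤ δ := (abs_nonneg _).trans (hδ 0)
  have hstep : ∀ k : ℕ, |u (j + k) - u j| ≤ k * δ := by
    intro k
    induction k with
    | zero => simp
    | succ k ih =>
      have h1 := hδ (j + k)
      have h2 := abs_sub_le (u (j + k + 1)) (u (j + k)) (u j)
      push_cast
      rw [← add_assoc]
      linarith
  have hall : ∀ i, |u j - u i| ≤ n * δ := by
    intro i
    have h1 := hstep (i - j).val
    rw [ZMod.natCast_zmod_val, add_sub_cancel, abs_sub_comm] at h1
    refine h1.trans (mul_le_mul_of_nonneg_right ?_ hδ0)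
    exact_mod_cast (ZMod.val_lt (i - j)).le
  have hn : (0 : ℝ) < n := by exact_mod_cast NeZero.pos n
  have h2 : (n : ℝ) * u j = ∑ i, (u j - u i) := by
    rw [Finset.sum_sub_distrib, hu]
    simp [ZMod.card]
  have h3 : (n : ℝ) * |u j| ≤ n * (n * δ) := by
    rw [← abs_of_pos hn, ← abs_mul, abs_of_pos hn, h2]
    refine (Finset.abs_sum_le_sum_abs _ _).trans ((Finset.sum_le_sum fun i _ => hall i).trans ?_)
    simp [ZMod.card]
  exact le_of_mul_le_mul_left h3 hn

variable (n) in
/-- The discretized symplectic action operator `-J d/dt` on loops `ZMod n → ℝ⁴`, with forward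
differences in the `y`-coordinates and backward differences in the `x`-coordinates. -/
def discreteAction : PiLp 2 (fun _ : ZMod n => R4) →ₗ[ℝ] PiLp 2 (fun _ : ZMod n => R4) where
  toFun x := WithLp.toLp 2 fun j => !₂[n * (x (j + 1) 1 - x j 1), n * (x (j - 1) 0 - x j 0),
    n * (x (j + 1) 3 - x j 3), n * (x (j - 1) 2 - x j 2)]
  map_add' x y := by
    ext j i
    fin_cases i <;> simp <;> ring
  map_smul' s x := by
    ext j i
    fin_cases i <;> simp <;> ring

theorem discreteAction_isSymmetric : (discreteAction n).IsSymmetric := by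
  intro x y
  have hs : ∀ u v : ZMod n → ℝ, ∑ j, u (j - 1) * v j = ∑ j, u j * v (j + 1) := fun u v =>
    Fintype.sum_equiv (Equiv.subRight 1) _ _ fun j => by simp
  have h0 := hs (fun j => x j 0) (fun j => y j 1)
  have h1 := hs (fun j => y j 0) (fun j => x j 1)
  have h2 := hs (fun j => x j 2) (fun j => y j 3)
  have h3 := hs (fun j => y j 2) (fun j => x j 3)
  simp only [PiLp.inner_apply, discreteAction, LinearMap.coe_mk, AddHom.coe_mk, Fin.sum_univ_four]
  simp
  rw [← sub_eq_zero, ← Finset.sum_sub_distrib]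
  trans (n : ℝ) * ((∑ j, y j 0 * x (j + 1) 1 - ∑ j, y (j - 1) 0 * x j 1) +
    (∑ j, x (j - 1) 0 * y j 1 - ∑ j, x j 0 * y (j + 1) 1) +
    (∑ j, y j 2 * x (j + 1) 3 - ∑ j, y (j - 1) 2 * x j 3) +
    (∑ j, x (j - 1) 2 * y j 3 - ∑ j, x j 2 * y (j + 1) 3))
  · simp only [← Finset.sum_sub_distrib, ← Finset.sum_add_distrib, Finset.mul_sum]
    exact Finset.sum_congr rfl fun j _ => by ring
  · rw [h0, h1, h2, h3]; ring

theorem one_le_of_discreteAction_eq_smul {r : ℝ} {x : PiLp 2 (fun _ : ZMod n => R4)} (hr : 0 < r)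
    (hx : x ≠ 0) (h : discreteAction n x = r • x) : 1 ≤ r := by
  have hn : (0 : ℝ) < n := by exact_mod_cast NeZero.pos n
  obtain ⟨⟨j₀, i₀⟩, hmax⟩ := Finite.exists_max fun z : ZMod n × Fin 4 => |x z.1 z.2|
  set M := |x j₀ i₀| with hM
  have hmax' : ∀ j i, |x j i| ≤ M := fun j i => hmax (j, i)
  have hM0 : 0 < M := by
    by_contra! hM0
    refine hx ?_
    ext j i
    exact abs_nonpos_iff.1 ((hmax' j i).trans hM0)
  have hcoord : ∀ j i, discreteAction n x j i = r * x j i := fun j i => by rw [h]; simp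
  have e0 : ∀ j, n * (x (j + 1) 1 - x j 1) = r * x j 0 := fun j => by
    simpa [discreteAction] using hcoord j 0
  have e1 : ∀ j, n * (x j 0 - x (j + 1) 0) = r * x (j + 1) 1 := fun j => by
    simpa [discreteAction] using hcoord (j + 1) 1
  have e2 : ∀ j, n * (x (j + 1) 3 - x j 3) = r * x j 2 := fun j => by
    simpa [discreteAction] using hcoord j 2
  have e3 : ∀ j, n * (x j 2 - x (j + 1) 2) = r * x (j + 1) 3 := fun j => by
    simpa [discreteAction] using hcoord (j + 1) 3
  have hshift : ∀ u : ZMod n → ℝ, ∑ j, u (j + 1) = ∑ j, u j := fun u =>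
    Fintype.sum_equiv (Equiv.addRight 1) _ _ fun j => by simp
  have hsum : ∀ u v : ZMod n → ℝ, (∀ j, n * (u (j + 1) - u j) = r * v j) → ∑ j, v j = 0 := by
    intro u v huv
    have h1 : r * ∑ j, v j = 0 := by
      rw [Finset.mul_sum, ← Finset.sum_congr rfl fun j _ => huv j, ← Finset.mul_sum,
        Finset.sum_sub_distrib, hshift, sub_self, mul_zero]
    exact (mul_eq_zero.1 h1).resolve_left hr.ne'
  have hmain : ∀ u v : ZMod n → ℝ, (∑ j, u j = 0) → (∀ j, n * (u (j + 1) - u j) = r * v j) →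
      (∀ j, |v j| ≤ M) → ∀ j, |u j| ≤ r * M := by
    intro u v hu huv hv j
    have := ZMod.abs_le_of_sum_eq_zero hu (δ := r * M / n) (fun j => by
      have h1 : |(n : ℝ) * (u (j + 1) - u j)| = r * |v j| := by
        rw [huv, abs_mul, abs_of_pos hr]
      rw [abs_mul, abs_of_pos hn] at h1
      rw [le_div_iff₀ hn, mul_comm, h1]
      exact mul_le_mul_of_nonneg_left (hv j) hr.le) j
    rwa [mul_div_cancel₀ _ hn.ne'] at this
  have e1' : ∀ j, n * (x (j + 1) 0 - x j 0) = r * -x (j + 1) 1 := fun j => by linarith [e1 j]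
  have e3' : ∀ j, n * (x (j + 1) 2 - x j 2) = r * -x (j + 1) 3 := fun j => by linarith [e3 j]
  have s0 := hsum (fun j => x j 1) (fun j => x j 0) e0
  have s1 := hsum (fun j => x j 0) (fun j => -x (j + 1) 1) e1'
  have s2 := hsum (fun j => x j 3) (fun j => x j 2) e2
  have s3 := hsum (fun j => x j 2) (fun j => -x (j + 1) 3) e3'
  rw [Finset.sum_neg_distrib, neg_eq_zero, hshift fun j => x j 1] at s1
  rw [Finset.sum_neg_distrib, neg_eq_zero, hshift fun j => x j 3] at s3
  have hfin : M ≤ r * M := by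
    have m0 := hmain _ _ s0 e1' (fun j => by rw [abs_neg]; exact hmax' _ _) j₀
    have m1 := hmain _ _ s1 e0 (fun j => hmax' _ _) j₀
    have m2 := hmain _ _ s2 e3' (fun j => by rw [abs_neg]; exact hmax' _ _) j₀
    have m3 := hmain _ _ s3 e2 (fun j => hmax' _ _) j₀
    rw [hM]
    fin_cases i₀ <;> assumption
  nlinarith

theorem ZMod.cos_val_add_one_mul (j : ZMod n) (δ : ℝ) :
    cos (2 * π / n * (((j + 1).val : ℝ) + δ)) = cos (2 * π / n * ((j.val : ℝ) + 1 + δ)) := by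
  have hn : (n : ℝ) ≠ 0 := by exact_mod_cast NeZero.ne n
  obtain ⟨q, hq⟩ : ∃ q : ℕ, j.val + 1 = (j + 1).val + n * q := by
    refine ⟨(j.val + 1) / n, ?_⟩
    have : (j + 1).val = (j.val + 1) % n := by
      conv_lhs => rw [← ZMod.natCast_zmod_val j]
      rw [← Nat.cast_succ, ZMod.val_natCast]
    rw [this, Nat.mod_add_div]
  have hq' : (j.val : ℝ) + 1 = (j + 1).val + n * q := by exact_mod_cast hq
  rw [hq', show 2 * π / n * (((j + 1).val : ℝ) + n * q + δ) =
    2 * π / n * (((j + 1).val : ℝ) + δ) + q * (2 * π) by field_simp; ring]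
  exact (cos_add_nat_mul_two_pi _ q).symm

theorem exists_discreteAction_eq_smul (hn2 : 2 ≤ n) :
    ∃ (ν : ℝ) (e : PiLp 2 (fun _ : ZMod n => R4)), 0 < ν ∧ ν ≤ 2 * π ∧ ‖e‖ = 1 ∧
      discreteAction n e = ν • e := by
  have hn : (0 : ℝ) < n := by exact_mod_cast NeZero.pos n
  have hn2' : (2 : ℝ) ≤ n := by exact_mod_cast hn2
  set θ := 2 * π / n with hθ
  let a : ZMod n → ℝ := fun j => cos (θ * j.val)
  let b : ZMod n → ℝ := fun j => sin (θ * (j.val - 1 / 2))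
  have ha : ∀ j, a (j + 1) = cos (θ * (j.val + 1)) := fun j => by
    have h := ZMod.cos_val_add_one_mul j 0
    simp only [add_zero] at h
    exact h
  have hb : ∀ j, b (j + 1) = sin (θ * (j.val + 1 / 2)) := fun j => by
    have h := ZMod.cos_val_add_one_mul j (-1 / 2 - n / 4)
    have h1 : ∀ t : ℝ, cos (θ * (t + (-1 / 2 - n / 4))) = sin (θ * (t - 1 / 2)) := fun t => by
      rw [← cos_sub_pi_div_two, hθ]
      congr 1
      field_simp
      ring
    rw [← hθ, h1, h1] at h
    simp only [b, h]
    congr 1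
    ring
  let e : PiLp 2 (fun _ : ZMod n => R4) := WithLp.toLp 2 fun j => !₂[a j, b j, 0, 0]
  have he : discreteAction n e = (2 * n * sin (θ / 2)) • e := by
    have e0 : ∀ j, n * (b (j + 1) - b j) = 2 * n * sin (θ / 2) * a j := fun j => by
      rw [hb]
      simp only [a, b]
      rw [sin_sub_sin]
      ring_nf
    have e1 : ∀ j, n * (a (j - 1) - a j) = 2 * n * sin (θ / 2) * b j := fun j => by
      obtain ⟨i, rfl⟩ : ∃ i, j = i + 1 := ⟨j - 1, by ring⟩
      rw [hb, add_sub_cancel_right, ha]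
      simp only [a]
      rw [cos_sub_cos, show (θ * i.val - θ * (i.val + 1)) / 2 = -(θ / 2) by ring, sin_neg]
      ring_nf
    ext j i
    fin_cases i
    · simpa [discreteAction, e] using e0 j
    · simpa [discreteAction, e] using e1 j
    · simp [discreteAction, e]
    · simp [discreteAction, e]
  have he0 : e ≠ 0 := fun h => by
    have h1 : e 0 0 = 0 := by rw [h]; rfl
    simp [e, a] at h1
  have hθ2 : θ / 2 = π / n := by rw [hθ]; ring
  have hθpos : 0 < θ / 2 := by rw [hθ2]; positivity
  refine ⟨2 * n * sin (θ / 2), ‖e‖⁻¹ • e, ?_, ?_, ?_, ?_⟩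
  · refine mul_pos (by positivity) (sin_pos_of_pos_of_lt_pi hθpos ?_)
    rw [hθ2, div_lt_iff₀ hn]
    nlinarith [pi_pos]
  · have h1 := sin_le hθpos.le
    calc 2 * n * sin (θ / 2) ≤ 2 * n * (θ / 2) := by gcongr
      _ = 2 * π := by rw [hθ2]; field_simp
  · rw [norm_smul, norm_inv, norm_norm, inv_mul_cancel₀ (norm_ne_zero_iff.2 he0)]
  · rw [map_smul, he, smul_comm]

theorem hasFDerivAt_sum_piLp {ι H : Type*} [Fintype ι] [NormedAddCommGroup H]
    [InnerProductSpace ℝ H] {F : H → ℝ} {g : H → H}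
    (hF : ∀ x, HasFDerivAt F (innerSL ℝ (g x)) x) (x : PiLp 2 (fun _ : ι => H)) :
    HasFDerivAt (fun x : PiLp 2 (fun _ : ι => H) => ∑ j, F (x j))
      (innerSL ℝ (WithLp.toLp 2 fun j => g (x j))) x := by
  have h1 : ∀ j, HasFDerivAt (fun x : PiLp 2 (fun _ : ι => H) => F (x j))
      ((innerSL ℝ (g (x j))).comp (PiLp.proj 2 (fun _ : ι => H) j)) x := fun j =>
    (hF (x j)).comp x (PiLp.proj 2 (fun _ : ι => H) j).hasFDerivAt
  refine (HasFDerivAt.fun_sum fun j _ => h1 j).congr_fderiv ?_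
  ext v
  simp [PiLp.inner_apply]

theorem exists_discreteAction_eq_gradient (hn2 : 2 ≤ n) {F : R4 → ℝ} {g : R4 → R4}
    (hF : ∀ x, HasFDerivAt F (innerSL ℝ (g x)) x) (hg : Continuous g)
    (heuler : ∀ x, ⟪g x, x⟫ = 2 * F x) (hhom : ∀ x (s : ℝ), 0 < s → F (s • x) = s ^ 2 * F x)
    {c C : ℝ} (hc : 0 < c) (hcF : ∀ x, c * ‖x‖ ^ 2 ≤ F x) (hFC : ∀ x, F x ≤ C * ‖x‖ ^ 2) :
    ∃ x : PiLp 2 (fun _ : ZMod n => R4), x ≠ 0 ∧ ∃ b : ℝ, 1 / (8 * C) ≤ b ∧ b ≤ π / c ∧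
      discreteAction n x = b • WithLp.toLp 2 fun j => g (x j) := by
  obtain ⟨ν, e, hν, hν2, he, hLe⟩ := exists_discreteAction_eq_smul hn2
  have hG : Continuous fun x : PiLp 2 (fun _ : ZMod n => R4) =>
      (WithLp.toLp 2 fun j => g (x j) : PiLp 2 (fun _ : ZMod n => R4)) := by
    fun_prop
  have heuler' : ∀ x : PiLp 2 (fun _ : ZMod n => R4),
      ⟪(WithLp.toLp 2 fun j => g (x j) : PiLp 2 (fun _ : ZMod n => R4)), x⟫ =
        2 * ∑ j, F (x j) := fun x => by
    rw [PiLp.inner_apply, Finset.mul_sum]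
    exact Finset.sum_congr rfl fun j _ => heuler _
  have hhom' : ∀ (x : PiLp 2 (fun _ : ZMod n => R4)) (s : ℝ), 0 < s →
      ∑ j, F ((s • x) j) = s ^ 2 * ∑ j, F (x j) := fun x s hs => by
    rw [Finset.mul_sum]
    exact Finset.sum_congr rfl fun j _ => hhom _ _ hs
  have hcF' : ∀ x : PiLp 2 (fun _ : ZMod n => R4), c * ‖x‖ ^ 2 ≤ ∑ j, F (x j) := fun x => by
    rw [PiLp.norm_sq_eq_of_L2, Finset.mul_sum]
    exact Finset.sum_le_sum fun j _ => hcF _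
  have hFC' : ∀ x : PiLp 2 (fun _ : ZMod n => R4), ∑ j, F (x j) ≤ C * ‖x‖ ^ 2 := fun x => by
    rw [PiLp.norm_sq_eq_of_L2, Finset.mul_sum]
    exact Finset.sum_le_sum fun j _ => hFC _
  have hpos : ∀ (r : ℝ) (x : PiLp 2 (fun _ : ZMod n => R4)), 0 < r → x ≠ 0 →
      discreteAction n x = r • x → 1 ≤ r := fun r x hr hx h =>
    one_le_of_discreteAction_eq_smul hr hx h
  have key : ∃ x : PiLp 2 (fun _ : ZMod n => R4), x ≠ 0 ∧ ∃ b : ℝ, 1 / (8 * C) ≤ b ∧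
      b ≤ ν / (2 * c) ∧ discreteAction n x = b • WithLp.toLp 2 fun j => g (x j) :=
    exists_critical_point (discreteAction_isSymmetric (n := n)) (hasFDerivAt_sum_piLp hF) hG
      heuler' hhom' hc hcF' hFC' one_pos hν hpos he hLe
  have hνc : ν / (2 * c) ≤ π / c := by
    rw [← mul_div_mul_left π c two_ne_zero]
    gcongr
  obtain ⟨x, hx, b, hb1, hb2, hLx⟩ := key
  exact ⟨x, hx, b, hb1, hb2.trans hνc, hLx⟩

theorem exists_discrete_orbit (hn2 : 2 ≤ n) {F : R4 → ℝ} {g : R4 → R4}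
    (hF : ∀ x, HasFDerivAt F (innerSL ℝ (g x)) x) (hg : Continuous g)
    (heuler : ∀ x, ⟪g x, x⟫ = 2 * F x) (hhom : ∀ x (s : ℝ), 0 < s → F (s • x) = s ^ 2 * F x)
    {c C : ℝ} (hc : 0 < c) (hcF : ∀ x, c * ‖x‖ ^ 2 ≤ F x) (hFC : ∀ x, F x ≤ C * ‖x‖ ^ 2) :
    ∃ x : ZMod n → R4, x ≠ 0 ∧ ∃ b : ℝ, 1 / (8 * C) ≤ b ∧ b ≤ π / c ∧
      ∀ j, x (j + 1) - x j =
        (b / n) • !₂[-g (x (j + 1)) 1, g (x j) 0, -g (x (j + 1)) 3, g (x j) 2] := by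
  have hn : (0 : ℝ) < n := by exact_mod_cast NeZero.pos n
  obtain ⟨x, hx, b, hb1, hb2, hLx⟩ :=
    exists_discreteAction_eq_gradient hn2 hF hg heuler hhom hc hcF hFC
  refine ⟨x, fun h => hx ?_, b, hb1, hb2, fun j => ?_⟩
  · ext j i
    rw [h]
    rfl
  · have hcoord : ∀ j i, discreteAction n x j i = b * g (x j) i := fun j i => by
      rw [hLx]; simp
    have e0 : n * (x (j + 1) 1 - x j 1) = b * g (x j) 0 := by
      simpa [discreteAction] using hcoord j 0
    have e1 : n * (x j 0 - x (j + 1) 0) = b * g (x (j + 1)) 1 := by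
      simpa [discreteAction] using hcoord (j + 1) 1
    have e2 : n * (x (j + 1) 3 - x j 3) = b * g (x j) 2 := by
      simpa [discreteAction] using hcoord j 2
    have e3 : n * (x j 2 - x (j + 1) 2) = b * g (x (j + 1)) 3 := by
      simpa [discreteAction] using hcoord (j + 1) 3
    ext i
    fin_cases i <;> simp <;> field_simp <;> linarith

end DiscreteAction

section Limit

/-- The standard complex structure on `ℝ⁴`, with `y`-coordinates taken from `u` and
`x`-coordinates taken from `v`. -/
def mixedJ (u v : R4) : R4 := !₂[-u 1, v 0, -u 3, v 2]

theorem norm_mixedJ_le (u v : R4) : ‖mixedJ u v‖ ≤ ‖u‖ + ‖v‖ := by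
  refine abs_le_of_sq_le_sq' ?_ (by positivity) |>.2
  have hu := EuclideanSpace.norm_sq_eq u
  have hv := EuclideanSpace.norm_sq_eq v
  have h : ‖mixedJ u v‖ ^ 2 = u 1 ^ 2 + v 0 ^ 2 + u 3 ^ 2 + v 2 ^ 2 := by
    simp [EuclideanSpace.norm_sq_eq, mixedJ, Fin.sum_univ_four]
  simp only [Fin.sum_univ_four, Real.norm_eq_abs, sq_abs] at hu hv
  rw [h, add_sq, hu, hv]
  have := mul_nonneg (norm_nonneg u) (norm_nonneg v)
  nlinarith [sq_nonneg (u 0), sq_nonneg (u 2), sq_nonneg (v 1), sq_nonneg (v 3)]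

theorem mixedJ_sub (u v u' v' : R4) : mixedJ u v - mixedJ u' v' = mixedJ (u - u') (v - v') := by
  ext i
  fin_cases i <;> simp [mixedJ] <;> ring

theorem mixedJ_smul (s : ℝ) (u v : R4) : mixedJ (s • u) (s • v) = s • mixedJ u v := by
  ext i
  fin_cases i <;> simp [mixedJ]

theorem norm_le_exp_mul_norm {n : ℕ} [NeZero n] {E : Type*} [NormedAddCommGroup E]
    {x : ZMod n → E} {A : ℝ} (hA : 0 ≤ A) (hAn : 2 * A ≤ n)
    (h : ∀ j, ‖x (j + 1) - x j‖ ≤ A / n * (‖x (j + 1)‖ + ‖x j‖)) (i j : ZMod n) :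
    ‖x i‖ ≤ exp (4 * A) * ‖x j‖ := by
  have hn : (0 : ℝ) < n := by exact_mod_cast NeZero.pos n
  have hstep : ∀ j, ‖x (j + 1)‖ ≤ exp (4 * A / n) * ‖x j‖ := by
    intro j
    have h1 := h j
    have h2 := norm_sub_norm_le (x (j + 1)) (x j)
    have ha : A / n ≤ 1 / 2 := by rw [div_le_iff₀ hn]; linarith
    have ha0 : 0 ≤ A / n := by positivity
    have he := add_one_le_exp (4 * A / n)
    rw [mul_div_assoc] at he ⊢
    set a := A / n
    have h3 : ‖x (j + 1)‖ ≤ (4 * a + 1) * ‖x j‖ := by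
      have h4 : (1 - a) * ‖x (j + 1)‖ ≤ (1 + a) * ‖x j‖ := by linarith
      have h5 : (1 + a) * ‖x j‖ ≤ (1 - a) * ((4 * a + 1) * ‖x j‖) := by
        have : 0 ≤ 2 * a * (1 - 2 * a) * ‖x j‖ :=
          mul_nonneg (mul_nonneg (by linarith) (by linarith)) (norm_nonneg _)
        nlinarith
      exact le_of_mul_le_mul_left (h4.trans h5) (by linarith)
    exact h3.trans (mul_le_mul_of_nonneg_right he (norm_nonneg _))
  have hiter : ∀ k : ℕ, ‖x (j + k)‖ ≤ exp (k * (4 * A / n)) * ‖x j‖ := by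
    intro k
    induction k with
    | zero => simp
    | succ k ih =>
      push_cast
      rw [← add_assoc, add_mul, one_mul, add_comm _ (4 * A / n), Real.exp_add, mul_assoc]
      exact (hstep _).trans (mul_le_mul_of_nonneg_left ih (exp_pos _).le)
  have h1 := hiter (i - j).val
  rw [ZMod.natCast_zmod_val, add_sub_cancel] at h1
  refine h1.trans (mul_le_mul_of_nonneg_right (exp_le_exp.2 ?_) (norm_nonneg _))
  have h2 : ((i - j).val : ℝ) ≤ n := by exact_mod_cast (ZMod.val_lt (i - j)).le
  calc ((i - j).val : ℝ) * (4 * A / n) ≤ n * (4 * A / n) := by gcongr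
    _ = 4 * A := by field_simp

theorem norm_sub_sub_smul_le_of_step {E : Type*} [NormedAddCommGroup E] [NormedSpace ℝ E]
    {z : ℤ → E} {a : E} {δ : ℝ} {k l : ℤ}
    (h : ∀ i, min k l ≤ i → i < max k l → ‖z (i + 1) - z i - a‖ ≤ δ) :
    ‖z l - z k - ((l : ℝ) - k) • a‖ ≤ |(l : ℝ) - k| * δ := by
  wlog hkl : k ≤ l generalizing k l
  · have h1 := this (k := l) (l := k) (by rwa [min_comm, max_comm]) (le_of_not_ge hkl)
    have h2 : z l - z k - ((l : ℝ) - k) • a = -(z k - z l - ((k : ℝ) - l) • a) := by module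
    rwa [h2, norm_neg, abs_sub_comm]
  rw [min_eq_left hkl, max_eq_right hkl] at h
  induction l, hkl using Int.leInduction with
  | base => simp
  | succ l hkl ih =>
    have h1 := ih fun i hi hil => h i hi (by lia)
    have h2 := h l hkl (by lia)
    have hkl' : (k : ℝ) ≤ l := by exact_mod_cast hkl
    push_cast
    rw [abs_of_nonneg (by linarith)] at h1 ⊢
    calc ‖z (l + 1) - z k - ((l : ℝ) + 1 - k) • a‖
        = ‖(z l - z k - ((l : ℝ) - k) • a) + (z (l + 1) - z l - a)‖ := by
          congr 1
          rw [show (l : ℝ) + 1 - k = (l - k) + 1 by ring, add_smul, one_smul]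
          abel
      _ ≤ ((l : ℝ) - k) * δ + δ := (norm_add_le _ _).trans (add_le_add h1 h2)
      _ = ((l : ℝ) + 1 - k) * δ := by ring

theorem norm_sub_le_of_step {E : Type*} [NormedAddCommGroup E] [NormedSpace ℝ E]
    {z : ℤ → E} {δ : ℝ} (h : ∀ i, ‖z (i + 1) - z i‖ ≤ δ) (k l : ℤ) :
    ‖z l - z k‖ ≤ |(l : ℝ) - k| * δ := by
  simpa using norm_sub_sub_smul_le_of_step (z := z) (a := 0) (δ := δ) (k := k) (l := l)
    fun i _ _ => by simpa using h i

theorem abs_floor_sub_floor_le (x y : ℝ) : |(⌊x⌋ : ℝ) - ⌊y⌋| ≤ |x - y| + 1 := by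
  have h1 := Int.floor_le x
  have h2 := Int.lt_floor_add_one x
  have h3 := Int.floor_le y
  have h4 := Int.lt_floor_add_one y
  rw [abs_le]
  constructor <;> cases abs_cases (x - y) <;> linarith

theorem tendsto_floor_mul_div {ι : Type*} {l : Filter ι} {N : ι → ℝ} (hN : Tendsto N l atTop)
    (t : ℝ) : Tendsto (fun m => (⌊N m * t⌋ : ℝ) / N m) l (𝓝 t) := by
  have h0 : Tendsto (fun m => (N m)⁻¹) l (𝓝 0) := tendsto_inv_atTop_zero.comp hN
  have h1 : Tendsto (fun m => t - (N m)⁻¹) l (𝓝 t) := by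
    simpa using tendsto_const_nhds.sub h0
  refine tendsto_of_tendsto_of_tendsto_of_le_of_le' h1 tendsto_const_nhds ?_ ?_
  · filter_upwards [hN.eventually_gt_atTop 0] with m hm
    have := Int.lt_floor_add_one (N m * t)
    rw [le_div_iff₀ hm, sub_mul, inv_mul_cancel₀ hm.ne']
    linarith
  · filter_upwards [hN.eventually_gt_atTop 0] with m hm
    have := Int.floor_le (N m * t)
    rw [div_le_iff₀ hm]
    linarith

theorem exists_tendsto_ultrafilter {ι X : Type*} [TopologicalSpace X] (l : Ultrafilter ι)
    {u : ι → X} {K : Set X} (hK : IsCompact K) (hu : ∀ m, u m ∈ K) :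
    ∃ x ∈ K, Tendsto u l (𝓝 x) :=
  hK.ultrafilter_le_nhds' (l.map u) (Ultrafilter.mem_map.2 (Filter.univ_mem' hu))

theorem exists_limit_orbit {g : R4 → R4} (hg : Continuous g) {N : ℕ → ℕ}
    (hN : Tendsto N atTop atTop) (hN0 : ∀ m, 0 < N m) {z : ℕ → ℤ → R4} {b : ℕ → ℝ}
    {b₁ b₂ K D : ℝ} (hb₁ : 0 < b₁)
    (hb : ∀ m, b m ∈ Icc b₁ b₂) (hper : ∀ m k, z m (k + N m) = z m k) (hz0 : ∀ m, ‖z m 0‖ = 1)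
    (hzK : ∀ m k, ‖z m k‖ ≤ K) (hzD : ∀ m k, ‖z m (k + 1) - z m k‖ ≤ D / N m)
    (hz : ∀ m k, z m (k + 1) - z m k =
      (b m / N m) • mixedJ (g (z m (k + 1))) (g (z m k))) :
    ∃ (γ : ℝ → R4) (β : ℝ), 0 < β ∧ ‖γ 0‖ = 1 ∧ (∀ t, γ (t + 1) = γ t) ∧
      ∀ t, HasDerivAt γ (β • mixedJ (g (γ t)) (g (γ t))) t := by
  let l : Ultrafilter ℕ := hyperfilter ℕ
  have hl : (l : Filter ℕ) ≤ atTop := Nat.hyperfilter_le_atTop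
  have hNl : Tendsto (fun m => (N m : ℝ)) l atTop :=
    (tendsto_natCast_atTop_atTop.comp hN).mono_left hl
  have hNpos : ∀ m, (0 : ℝ) < N m := fun m => by exact_mod_cast hN0 m
  have hD : 0 ≤ D := by
    have h1 := (norm_nonneg _).trans (hzD 0 0)
    have h2 := mul_nonneg h1 (hNpos 0).le
    rwa [div_mul_cancel₀ _ (hNpos 0).ne'] at h2
  obtain ⟨β, hβ, hbβ⟩ := exists_tendsto_ultrafilter l isCompact_Icc hb
  have hlim : ∀ t : ℝ, ∃ x, Tendsto (fun m => z m ⌊(N m : ℝ) * t⌋) l (𝓝 x) := fun t => by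
    obtain ⟨x, -, hx⟩ := exists_tendsto_ultrafilter l (isCompact_closedBall (0 : R4) K)
      (u := fun m => z m ⌊(N m : ℝ) * t⌋) (fun m => by simpa using hzK m _)
    exact ⟨x, hx⟩
  choose γ hγ using hlim
  have hβ0 : 0 < β := hb₁.trans_le hβ.1
  refine ⟨γ, β, hβ0, ?_, fun t => ?_, fun t => ?_⟩
  · refine tendsto_nhds_unique (hγ 0).norm ?_
    simp [hz0]
  · refine tendsto_nhds_unique (hγ (t + 1)) ?_
    refine (hγ t).congr fun m => ?_
    rw [mul_add, mul_one, Int.floor_add_natCast, hper]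
  · rw [hasDerivAt_iff_isLittleO, Asymptotics.isLittleO_iff]
    intro ε hε
    set w := mixedJ (g (γ t)) (g (γ t)) with hw
    have hε' : 0 < ε / (2 * β) := by positivity
    obtain ⟨δ, hδ, hgδ⟩ := Metric.continuousAt_iff.1 (hg.continuousAt (x := γ t)) _ hε'
    have hr : ∀ᶠ s in 𝓝 t, D * |s - t| < δ / 3 := by
      have : Tendsto (fun s => D * |s - t|) (𝓝 t) (𝓝 (D * |t - t|)) :=
        Continuous.tendsto (by fun_prop) t
      rw [sub_self, abs_zero, mul_zero] at this
      exact this.eventually_lt_const (by positivity)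
    filter_upwards [hr] with s hs
    have e1 : ∀ᶠ m in (l : Filter ℕ), dist (z m ⌊(N m : ℝ) * t⌋) (γ t) < δ / 3 :=
      Metric.tendsto_nhds.1 (hγ t) _ (by positivity)
    have e2 : ∀ᶠ m in (l : Filter ℕ), D / N m < δ / 3 :=
      (hNl.const_div_atTop D).eventually_lt_const (by positivity)
    have hq : Tendsto (fun m => ((⌊(N m : ℝ) * s⌋ : ℝ) - ⌊(N m : ℝ) * t⌋) / N m) l
        (𝓝 (s - t)) := by
      simp_rw [sub_div]
      exact (tendsto_floor_mul_div hNl s).sub (tendsto_floor_mul_div hNl t)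
    have hmain : ∀ᶠ m in (l : Filter ℕ),
        ‖z m ⌊(N m : ℝ) * s⌋ - z m ⌊(N m : ℝ) * t⌋ -
          (((⌊(N m : ℝ) * s⌋ : ℝ) - ⌊(N m : ℝ) * t⌋) / N m) • b m • w‖ ≤
        |((⌊(N m : ℝ) * s⌋ : ℝ) - ⌊(N m : ℝ) * t⌋) / N m| * (b m * (ε / β)) := by
      filter_upwards [e1, e2] with m h1 h2
      have hb0 : 0 < b m := hb₁.trans_le (hb m).1
      set k := ⌊(N m : ℝ) * t⌋
      set k' := ⌊(N m : ℝ) * s⌋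
      have hkk : |(k' : ℝ) - k| ≤ N m * |s - t| + 1 := by
        refine (abs_floor_sub_floor_le _ _).trans_eq ?_
        rw [← mul_sub, abs_mul, abs_of_pos (hNpos m)]
      have hclose : ∀ i, min k k' ≤ i → i ≤ max k k' →
          ‖g (z m i) - g (γ t)‖ ≤ ε / (2 * β) := by
        intro i hi1 hi2
        have h3 : |(i : ℝ) - k| ≤ |(k' : ℝ) - k| := by
          have : |i - k| ≤ |k' - k| := by
            rcases le_total k k' with h | h
            · rw [min_eq_left h] at hi1; rw [max_eq_right h] at hi2
              rw [abs_of_nonneg (by lia), abs_of_nonneg (by lia)]; lia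
            · rw [min_eq_right h] at hi1; rw [max_eq_left h] at hi2
              rw [abs_of_nonpos (by lia), abs_of_nonpos (by lia)]; lia
          exact_mod_cast this
        have h4 : ‖z m i - z m k‖ ≤ D * |s - t| + D / N m := by
          refine (norm_sub_le_of_step (hzD m) k i).trans ?_
          calc |(i : ℝ) - k| * (D / N m) ≤ (N m * |s - t| + 1) * (D / N m) := by
                gcongr
                exact h3.trans hkk
            _ = D * |s - t| + D / N m := by field_simp [(hNpos m).ne']
        have h5 : dist (z m i) (γ t) < δ := by
          refine (dist_triangle _ (z m k) _).trans_lt ?_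
          rw [dist_eq_norm (z m i)]
          linarith
        rw [← dist_eq_norm]
        exact (hgδ h5).le
      have hstep : ∀ i, min k k' ≤ i → i < max k k' →
          ‖z m (i + 1) - z m i - (b m / N m) • w‖ ≤ b m / N m * (ε / β) := by
        intro i hi1 hi2
        have h3 := hclose i hi1 hi2.le
        have h4 := hclose (i + 1) (by lia) (by lia)
        rw [hz, ← smul_sub, hw, mixedJ_sub, norm_smul, Real.norm_of_nonneg (by positivity)]
        gcongr
        refine (norm_mixedJ_le _ _).trans ((add_le_add h4 h3).trans_eq ?_)
        field_simp
        norm_num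
      have h6 := norm_sub_sub_smul_le_of_step hstep
      rw [abs_div, abs_of_pos (hNpos m)]
      convert h6 using 1
      · congr 2
        rw [smul_smul, smul_smul]
        congr 1
        ring
      · ring
    have hL : Tendsto (fun m => ‖z m ⌊(N m : ℝ) * s⌋ - z m ⌊(N m : ℝ) * t⌋ -
          (((⌊(N m : ℝ) * s⌋ : ℝ) - ⌊(N m : ℝ) * t⌋) / N m) • b m • w‖) l
        (𝓝 ‖γ s - γ t - (s - t) • β • w‖) :=
      (((hγ s).sub (hγ t)).sub (hq.smul (hbβ.smul_const w))).norm
    have hR : Tendsto (fun m =>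
          |((⌊(N m : ℝ) * s⌋ : ℝ) - ⌊(N m : ℝ) * t⌋) / N m| * (b m * (ε / β))) l
        (𝓝 (|s - t| * (β * (ε / β)))) :=
      hq.abs.mul (hbβ.mul_const _)
    have := le_of_tendsto_of_tendsto hL hR hmain
    rwa [mul_div_cancel₀ _ hβ0.ne', mul_comm] at this

theorem gradient_smul_of_homogeneous {E : Type*} [NormedAddCommGroup E] [InnerProductSpace ℝ E]
    {F : E → ℝ} {g : E → E} (hF : ∀ x, HasFDerivAt F (innerSL ℝ (g x)) x)
    (hhom : ∀ x (s : ℝ), 0 < s → F (s • x) = s ^ 2 * F x) {s : ℝ} (hs : 0 < s) (x : E) :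
    g (s • x) = s • g x := by
  have h1 : HasFDerivAt (fun y => F (s • y))
      ((innerSL ℝ (g (s • x))).comp (s • ContinuousLinearMap.id ℝ E)) x :=
    (hF (s • x)).comp x ((hasFDerivAt_id x).const_smul s)
  have h2 : HasFDerivAt (fun y => F (s • y)) (s ^ 2 • innerSL ℝ (g x)) x := by
    simp_rw [hhom _ _ hs]
    exact (hF x).const_mul _
  refine ext_inner_right ℝ fun v => ?_
  have h3 := DFunLike.congr_fun (h1.unique h2) v
  simp only [ContinuousLinearMap.comp_apply, smul_apply, innerSL_apply_apply,
    ContinuousLinearMap.id_apply, inner_smul_right, smul_eq_mul] at h3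
  rw [inner_smul_left, conj_trivial]
  refine mul_left_cancel₀ hs.ne' (h3.trans ?_)
  ring

theorem exists_norm_le_mul_norm_of_homogeneous {E : Type*} [NormedAddCommGroup E]
    [NormedSpace ℝ E] [FiniteDimensional ℝ E] {g : E → E} (hg : Continuous g) (hg0 : g 0 = 0)
    (hhom : ∀ x (s : ℝ), 0 < s → g (s • x) = s • g x) :
    ∃ A, 0 ≤ A ∧ ∀ x, ‖g x‖ ≤ A * ‖x‖ := by
  obtain ⟨A, hA⟩ := (isCompact_closedBall (0 : E) 1).exists_bound_of_continuousOn hg.continuousOn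
  refine ⟨A, (norm_nonneg _).trans (hA 0 (by simp)), fun x => ?_⟩
  rcases eq_or_ne x 0 with rfl | hx
  · simp [hg0]
  · have hx0 := norm_pos_iff.2 hx
    have h1 := hA (‖x‖⁻¹ • x) (by simp [norm_smul, inv_mul_cancel₀ hx0.ne'])
    rw [hhom _ _ (inv_pos.2 hx0), norm_smul, norm_inv, norm_norm] at h1
    rwa [inv_mul_le_iff₀ hx0, mul_comm] at h1

theorem exists_periodic_orbit {F : R4 → ℝ} {g : R4 → R4}
    (hF : ∀ x, HasFDerivAt F (innerSL ℝ (g x)) x) (hg : Continuous g) (hg0 : g 0 = 0)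
    (heuler : ∀ x, ⟪g x, x⟫ = 2 * F x) (hhom : ∀ x (s : ℝ), 0 < s → F (s • x) = s ^ 2 * F x)
    {c C : ℝ} (hc : 0 < c) (hC : 0 < C) (hcF : ∀ x, c * ‖x‖ ^ 2 ≤ F x)
    (hFC : ∀ x, F x ≤ C * ‖x‖ ^ 2) :
    ∃ (γ : ℝ → R4) (β : ℝ), 0 < β ∧ ‖γ 0‖ = 1 ∧ (∀ t, γ (t + 1) = γ t) ∧
      ∀ t, HasDerivAt γ (β • mixedJ (g (γ t)) (g (γ t))) t := by
  have hghom : ∀ x (s : ℝ), 0 < s → g (s • x) = s • g x := fun x s hs =>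
    gradient_smul_of_homogeneous hF hhom hs x
  obtain ⟨A, hA0, hA⟩ := exists_norm_le_mul_norm_of_homogeneous hg hg0 hghom
  set B := π / c * A with hB
  have hB0 : 0 ≤ B := by positivity
  obtain ⟨n₀, hn₀⟩ := exists_nat_ge (2 * B)
  have hkey : ∀ m : ℕ, ∃ (z : ℤ → R4) (b : ℝ), b ∈ Icc (1 / (8 * C)) (π / c) ∧
      (∀ k, z (k + (m + n₀ + 2 : ℕ)) = z k) ∧ ‖z 0‖ = 1 ∧ (∀ k, ‖z k‖ ≤ exp (4 * B)) ∧
      (∀ k, ‖z (k + 1) - z k‖ ≤ B * (2 * exp (4 * B)) / (m + n₀ + 2 : ℕ)) ∧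
      ∀ k, z (k + 1) - z k = (b / (m + n₀ + 2 : ℕ)) • mixedJ (g (z (k + 1))) (g (z k)) := by
    intro m
    set n := m + n₀ + 2 with hn
    have : NeZero n := ⟨by lia⟩
    have hnpos : (0 : ℝ) < n := by exact_mod_cast NeZero.pos n
    obtain ⟨x, hx0, b, hb1, hb2, hx⟩ :=
      exists_discrete_orbit (n := n) (by lia) hF hg heuler hhom hc hcF hFC
    have hb0 : 0 < b := lt_of_lt_of_le (by positivity) hb1
    have hstep : ∀ j, ‖x (j + 1) - x j‖ ≤ B / n * (‖x (j + 1)‖ + ‖x j‖) := by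
      intro j
      rw [hx, norm_smul, Real.norm_of_nonneg (by positivity)]
      calc b / n * ‖mixedJ (g (x (j + 1))) (g (x j))‖
          ≤ π / c / n * (A * ‖x (j + 1)‖ + A * ‖x j‖) := by
            gcongr
            exact (norm_mixedJ_le _ _).trans (add_le_add (hA _) (hA _))
        _ = B / n * (‖x (j + 1)‖ + ‖x j‖) := by rw [hB]; ring
    have hBn : 2 * B ≤ n := hn₀.trans (by rw [hn]; push_cast; linarith [Nat.cast_nonneg (α := ℝ) m])
    have hgrow := norm_le_exp_mul_norm hB0 hBn hstep
    have hx00 : 0 < ‖x 0‖ := by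
      rw [norm_pos_iff]
      intro h0
      refine hx0 (funext fun i => ?_)
      have := hgrow i 0
      rw [h0, norm_zero, mul_zero] at this
      exact norm_le_zero_iff.1 this
    set r := ‖x 0‖⁻¹ with hr
    have hr0 : 0 < r := inv_pos.2 hx00
    have hbound : ∀ i, ‖r • x i‖ ≤ exp (4 * B) := fun i => by
      rw [norm_smul, hr, norm_inv, norm_norm, inv_mul_le_iff₀ hx00, mul_comm]
      exact hgrow i 0
    refine ⟨fun k => r • x k, b, ⟨hb1, hb2⟩, fun k => by simp, ?_, fun k => hbound _,
      fun k => ?_, fun k => ?_⟩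
    · simp [norm_smul, hr, inv_mul_cancel₀ hx00.ne']
    · push_cast
      rw [← smul_sub, norm_smul]
      have h1 := mul_le_mul_of_nonneg_left (hstep k) (norm_nonneg r)
      have h2 := hbound (k + 1)
      have h3 := hbound k
      rw [norm_smul] at h2 h3
      calc ‖r‖ * ‖x (k + 1) - x k‖ ≤ B / n * (‖r‖ * ‖x (k + 1)‖ + ‖r‖ * ‖x k‖) := by
            refine h1.trans_eq ?_
            ring
        _ ≤ B / n * (exp (4 * B) + exp (4 * B)) := by gcongr
        _ = B * (2 * exp (4 * B)) / n := by ring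
    · push_cast
      rw [hghom _ _ hr0, hghom _ _ hr0, mixedJ_smul, ← smul_sub, hx, smul_comm]
      rfl
  choose z b hb hper hz0 hzK hzD hz using hkey
  exact exists_limit_orbit hg (N := fun m => m + n₀ + 2)
    (tendsto_atTop_mono (fun m => show m ≤ m + n₀ + 2 by lia) tendsto_id) (fun m => by lia)
    (by positivity) hb hper hz0 hzK hzD hz

end Limit

section Hamiltonian

variable {E : Type*} [NormedAddCommGroup E] [InnerProductSpace ℝ E]

/-- The `2`-homogeneous function whose level set `1` is the star-shaped hypersurface
`{√(f p) • p : ‖p‖ = 1}`. -/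
def starHamiltonian (f : E → ℝ) (x : E) : ℝ := ‖x‖ ^ 2 / f (‖x‖⁻¹ • x)

variable {f : E → ℝ}

theorem starHamiltonian_smul (x : E) {s : ℝ} (hs : 0 < s) :
    starHamiltonian f (s • x) = s ^ 2 * starHamiltonian f x := by
  have h : ‖s • x‖⁻¹ • s • x = ‖x‖⁻¹ • x := by
    rw [norm_smul, Real.norm_of_nonneg hs.le, smul_smul, mul_inv, mul_right_comm,
      inv_mul_cancel₀ hs.ne', one_mul]
  rw [starHamiltonian, h, norm_smul, Real.norm_of_nonneg hs.le, mul_pow, mul_div_assoc,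
    starHamiltonian]

theorem starHamiltonian_zero : starHamiltonian f 0 = 0 := by simp [starHamiltonian]

theorem inv_norm_smul_mem_sphere {x : E} (hx : x ≠ 0) :
    ‖x‖⁻¹ • x ∈ Metric.sphere (0 : E) 1 := by
  simp [norm_smul, inv_mul_cancel₀ (norm_ne_zero_iff.2 hx)]

theorem contDiffAt_starHamiltonian (hf : ContDiff ℝ ∞ f)
    (hfpos : ∀ p ∈ Metric.sphere (0 : E) 1, 0 < f p) {x : E} (hx : x ≠ 0) :
    ContDiffAt ℝ ∞ (starHamiltonian f) x := by
  have hn : ContDiffAt ℝ ∞ (fun y : E => ‖y‖) x := contDiffAt_norm ℝ hx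
  refine (hn.pow 2).div ?_ (hfpos _ (inv_norm_smul_mem_sphere hx)).ne'
  exact hf.contDiffAt.comp x ((hn.inv (norm_ne_zero_iff.2 hx)).smul contDiffAt_id)

variable [FiniteDimensional ℝ E]

theorem exists_bounds_starHamiltonian (hf : Continuous f)
    (hfpos : ∀ p ∈ Metric.sphere (0 : E) 1, 0 < f p) :
    ∃ c > 0, ∃ C > 0, ∀ x, c * ‖x‖ ^ 2 ≤ starHamiltonian f x ∧
      starHamiltonian f x ≤ C * ‖x‖ ^ 2 := by
  obtain ⟨a, ha, hfa⟩ := (isCompact_sphere (0 : E) 1).exists_forall_le' hf.continuousOn hfpos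
  obtain ⟨A, hA⟩ := (isCompact_sphere (0 : E) 1).exists_bound_of_continuousOn hf.continuousOn
  refine ⟨(max A 1)⁻¹, by positivity, a⁻¹, by positivity, fun x => ?_⟩
  rcases eq_or_ne x 0 with rfl | hx
  · simp [starHamiltonian_zero]
  have hp := inv_norm_smul_mem_sphere hx
  have h0 := hfpos _ hp
  simp only [starHamiltonian, div_eq_mul_inv, mul_comm _ (‖x‖ ^ 2)]
  constructor
  · gcongr
    exact (le_abs_self _).trans ((hA _ hp).trans (le_max_left _ _))
  · gcongr
    exact hfa _ hp

/-- The gradient of `starHamiltonian f`. -/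
def starGradient (f : E → ℝ) (x : E) : E := gradient (starHamiltonian f) x

theorem hasFDerivAt_starHamiltonian (hf : ContDiff ℝ ∞ f)
    (hfpos : ∀ p ∈ Metric.sphere (0 : E) 1, 0 < f p) (x : E) :
    HasFDerivAt (starHamiltonian f) (innerSL ℝ (starGradient f x)) x := by
  have hd : DifferentiableAt ℝ (starHamiltonian f) x := by
    rcases eq_or_ne x 0 with rfl | hx
    · obtain ⟨c, hc, C, hC, hb⟩ := exists_bounds_starHamiltonian hf.continuous hfpos
      have hO : starHamiltonian f =O[𝓝 0] fun x => ‖x - 0‖ ^ 2 := by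
        refine Asymptotics.IsBigO.of_bound C (Eventually.of_forall fun x => ?_)
        have h1 : 0 ≤ starHamiltonian f x := (by positivity : 0 ≤ c * ‖x‖ ^ 2).trans (hb x).1
        simpa [abs_of_nonneg h1] using (hb x).2
      exact (hO.hasFDerivAt one_lt_two).differentiableAt
    · exact (contDiffAt_starHamiltonian hf hfpos hx).differentiableAt (by simp)
  exact hd.hasGradientAt.hasFDerivAt

theorem contDiffAt_starGradient (hf : ContDiff ℝ ∞ f)
    (hfpos : ∀ p ∈ Metric.sphere (0 : E) 1, 0 < f p) {x : E} (hx : x ≠ 0) :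
    ContDiffAt ℝ ∞ (starGradient f) x :=
  (InnerProductSpace.toDual ℝ E).symm.toContinuousLinearEquiv.contDiff.contDiffAt.comp x
    ((contDiffAt_starHamiltonian hf hfpos hx).fderiv_right (m := ∞) (by simp))

theorem starGradient_smul (hf : ContDiff ℝ ∞ f)
    (hfpos : ∀ p ∈ Metric.sphere (0 : E) 1, 0 < f p) {s : ℝ} (hs : 0 < s) (x : E) :
    starGradient f (s • x) = s • starGradient f x :=
  gradient_smul_of_homogeneous (hasFDerivAt_starHamiltonian hf hfpos)
    (fun x _ hs => starHamiltonian_smul x hs) hs x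

theorem starGradient_zero (hf : ContDiff ℝ ∞ f)
    (hfpos : ∀ p ∈ Metric.sphere (0 : E) 1, 0 < f p) : starGradient f 0 = 0 := by
  have h := starGradient_smul hf hfpos two_pos 0
  rw [smul_zero, two_smul] at h
  exact left_eq_add.1 h

theorem continuous_starGradient (hf : ContDiff ℝ ∞ f)
    (hfpos : ∀ p ∈ Metric.sphere (0 : E) 1, 0 < f p) : Continuous (starGradient f) := by
  rw [continuous_iff_continuousAt]
  intro x
  rcases eq_or_ne x 0 with rfl | hx
  · obtain ⟨A, hA⟩ := (isCompact_sphere (0 : E) 1).exists_bound_of_continuousOn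
      (f := starGradient f) fun x hx => (contDiffAt_starGradient hf hfpos
        (by rintro rfl; simp at hx)).continuousAt.continuousWithinAt
    have hbound : ∀ x, ‖starGradient f x‖ ≤ A * ‖x‖ := by
      intro x
      rcases eq_or_ne x 0 with rfl | hx
      · simp [starGradient_zero hf hfpos]
      · have h1 := hA _ (inv_norm_smul_mem_sphere hx)
        have hx0 := norm_pos_iff.2 hx
        rwa [starGradient_smul hf hfpos (inv_pos.2 hx0), norm_smul, norm_inv, norm_norm,
          inv_mul_le_iff₀ hx0, mul_comm] at h1
    rw [ContinuousAt, starGradient_zero hf hfpos]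
    refine squeeze_zero_norm hbound ?_
    simpa using (tendsto_norm_zero (E := E)).const_mul A
  · exact (contDiffAt_starGradient hf hfpos hx).continuousAt

theorem inner_starGradient_self (hf : ContDiff ℝ ∞ f)
    (hfpos : ∀ p ∈ Metric.sphere (0 : E) 1, 0 < f p) (x : E) :
    ⟪starGradient f x, x⟫ = 2 * starHamiltonian f x := by
  have h1 : HasDerivAt (fun s : ℝ => s • x) x 1 := by
    simpa using (hasDerivAt_id (1 : ℝ)).smul_const x
  have h2 := (hasFDerivAt_starHamiltonian hf hfpos ((1 : ℝ) • x)).comp_hasDerivAt (1 : ℝ) h1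
  have h3 : HasDerivAt (fun s : ℝ => s ^ 2 * starHamiltonian f x) (2 * starHamiltonian f x) 1 := by
    simpa using (hasDerivAt_pow 2 (1 : ℝ)).mul_const (starHamiltonian f x)
  have h4 : HasDerivAt (starHamiltonian f ∘ fun s : ℝ => s • x) (2 * starHamiltonian f x) 1 := by
    refine h3.congr_of_eventuallyEq ?_
    filter_upwards [lt_mem_nhds one_pos] with s hs
    exact starHamiltonian_smul x hs
  simpa using h2.unique h4

end Hamiltonian

section ReebOrbit

theorem omegaSt_eq_inner (u v : R4) : omegaSt u v = ⟪mixedJ u u, v⟫ := by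
  simp [omegaSt, mixedJ, PiLp.inner_apply, Fin.sum_univ_four]
  ring

theorem inner_mixedJ_right_self (u : R4) : ⟪u, mixedJ u u⟫ = 0 := by
  simp [mixedJ, PiLp.inner_apply, Fin.sum_univ_four]
  ring

theorem inner_mixedJ_mixedJ (u v : R4) : ⟪mixedJ u u, mixedJ v v⟫ = ⟪u, v⟫ := by
  simp [mixedJ, PiLp.inner_apply, Fin.sum_univ_four]
  ring

theorem mixedJ_mixedJ (u : R4) : mixedJ (mixedJ u u) (mixedJ u u) = -u := by
  ext i
  fin_cases i <;> simp [mixedJ]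

theorem contDiff_mixedJ_self {n : WithTop ℕ∞} : ContDiff ℝ n fun u : R4 => mixedJ u u := by
  rw [contDiff_euclidean]
  intro i
  fin_cases i <;> simp [mixedJ] <;> fun_prop

variable {f : R4 → ℝ}

theorem exists_periodic_orbit_on_level_one (hf : ContDiff ℝ ∞ f)
    (hfpos : ∀ p ∈ Metric.sphere (0 : R4) 1, 0 < f p) :
    ∃ (T : ℝ) (γ : ℝ → R4), 0 < T ∧ (∀ t, γ (t + T) = γ t) ∧
      (∀ t, starHamiltonian f (γ t) = 1) ∧
      ∀ t, HasDerivAt γ (mixedJ (starGradient f (γ t)) (starGradient f (γ t))) t := by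
  obtain ⟨c, hc, C, hC, hbd⟩ := exists_bounds_starHamiltonian hf.continuous hfpos
  obtain ⟨γ, β, hβ, hγ0, hper, hder⟩ := exists_periodic_orbit (hasFDerivAt_starHamiltonian hf hfpos)
    (continuous_starGradient hf hfpos) (starGradient_zero hf hfpos)
    (inner_starGradient_self hf hfpos) (fun x _ hs => starHamiltonian_smul x hs) hc hC
    (fun x => (hbd x).1) (fun x => (hbd x).2)
  have hconst : ∀ t, starHamiltonian f (γ t) = starHamiltonian f (γ 0) := by
    have hd : ∀ t, HasDerivAt (fun t => starHamiltonian f (γ t)) 0 t := fun t => by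
      refine ((hasFDerivAt_starHamiltonian hf hfpos (γ t)).comp_hasDerivAt t
        (hder t)).congr_deriv ?_
      simp [inner_mixedJ_right_self]
    exact fun t => is_const_of_deriv_eq_zero (fun t => (hd t).differentiableAt)
      (fun t => (hd t).deriv) t 0
  set E₀ := starHamiltonian f (γ 0)
  have hE₀ : 0 < E₀ := by
    have := (hbd (γ 0)).1
    rw [hγ0, one_pow, mul_one] at this
    exact hc.trans_le this
  have hs : 0 < (√E₀)⁻¹ := inv_pos.2 (Real.sqrt_pos.2 hE₀)
  refine ⟨β, fun t => (√E₀)⁻¹ • γ (t / β), hβ, fun t => ?_, fun t => ?_, fun t => ?_⟩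
  · simp only [add_div, div_self hβ.ne', hper]
  · rw [starHamiltonian_smul _ hs, hconst, inv_pow, Real.sq_sqrt hE₀.le, inv_mul_cancel₀ hE₀.ne']
  · have h1 : HasDerivAt (fun t : ℝ => t / β) (1 / β) t := (hasDerivAt_id t).div_const β
    refine (((hder (t / β)).scomp t h1).const_smul (√E₀)⁻¹).congr_deriv ?_
    rw [starGradient_smul hf hfpos hs, mixedJ_smul, smul_smul (1 / β), one_div,
      inv_mul_cancel₀ hβ.ne', one_smul]

theorem contDiff_of_hasDerivAt_autonomous {E : Type*} [NormedAddCommGroup E] [NormedSpace ℝ E]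
    {γ : ℝ → E} {X : E → E} (hγ : ∀ t, HasDerivAt γ (X (γ t)) t)
    (hX : ∀ t, ContDiffAt ℝ ∞ X (γ t)) : ContDiff ℝ ∞ γ := by
  rw [contDiff_infty]
  intro n
  induction n with
  | zero =>
    exact contDiff_zero.2 (continuous_iff_continuousAt.2 fun t => (hγ t).continuousAt)
  | succ n ih =>
    push_cast
    rw [contDiff_succ_iff_deriv]
    refine ⟨fun t => (hγ t).differentiableAt, by simp, ?_⟩
    rw [show deriv γ = fun t => X (γ t) from funext fun t => (hγ t).deriv]
    refine contDiff_iff_contDiffAt.2 fun t => ?_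
    exact ((hX t).of_le (by exact_mod_cast le_top)).comp t ih.contDiffAt

theorem sqrt_smul_inv_norm_smul_eq {x : R4} (hx : starHamiltonian f x = 1) :
    x ≠ 0 ∧ √(f (‖x‖⁻¹ • x)) • ‖x‖⁻¹ • x = x := by
  have hx0 : x ≠ 0 := by
    rintro rfl
    simp [starHamiltonian_zero] at hx
  have h1 : f (‖x‖⁻¹ • x) = ‖x‖ ^ 2 := by
    rw [starHamiltonian, div_eq_one_iff_eq] at hx
    · exact hx.symm
    · intro h
      simp [h] at hx
  refine ⟨hx0, ?_⟩
  rw [h1, Real.sqrt_sq (norm_nonneg _), smul_smul, mul_inv_cancel₀ (norm_ne_zero_iff.2 hx0),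
    one_smul]

theorem starHamiltonian_sqrt_smul (hfpos : ∀ p ∈ Metric.sphere (0 : R4) 1, 0 < f p) {p : R4}
    (hp : p ∈ Metric.sphere (0 : R4) 1) : starHamiltonian f (√(f p) • p) = 1 := by
  have h0 := hfpos p hp
  rw [starHamiltonian_smul _ (Real.sqrt_pos.2 h0), Real.sq_sqrt h0.le, starHamiltonian,
    mem_sphere_zero_iff_norm.1 hp]
  simp [h0.ne']

theorem differentiableAt_sqrt_smul (hf : ContDiff ℝ ∞ f)
    {p : R4} (hp : 0 < f p) : DifferentiableAt ℝ (fun x => √(f x) • x) p :=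
  ((hf.differentiable (by simp) p).sqrt hp.ne').smul differentiableAt_id

theorem exists_curve_in_sphere {E : Type*} [NormedAddCommGroup E] [InnerProductSpace ℝ E] {p v : E}
    (hp : ‖p‖ = 1) (hpv : ⟪p, v⟫ = 0) :
    ∃ c : ℝ → E, c 0 = p ∧ HasDerivAt c v 0 ∧ ∀ s, ‖c s‖ = 1 := by
  have hpos : ∀ s : ℝ, 0 < 1 + s ^ 2 * ‖v‖ ^ 2 := fun s => by positivity
  refine ⟨fun s => (√(1 + s ^ 2 * ‖v‖ ^ 2))⁻¹ • (p + s • v), by simp, ?_, fun s => ?_⟩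
  · have h1 : HasDerivAt (fun s : ℝ => 1 + s ^ 2 * ‖v‖ ^ 2) 0 0 := by
      simpa using ((hasDerivAt_pow 2 (0 : ℝ)).mul_const (‖v‖ ^ 2)).const_add 1
    have h2 := (h1.sqrt (hpos 0).ne').inv (Real.sqrt_pos.2 (hpos 0)).ne'
    have h3 : HasDerivAt (fun s : ℝ => p + s • v) v 0 := by
      simpa using ((hasDerivAt_id (0 : ℝ)).smul_const v).const_add p
    exact (h2.fun_smul h3).congr_deriv (by simp)
  · have h1 : ‖p + s • v‖ ^ 2 = 1 + s ^ 2 * ‖v‖ ^ 2 := by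
      rw [norm_add_sq_real, inner_smul_right, hpv, norm_smul, hp, mul_pow, Real.norm_eq_abs, sq_abs]
      ring
    rw [norm_smul, ← h1, Real.sqrt_sq (norm_nonneg _), norm_inv, norm_norm, inv_mul_cancel₀]
    intro h
    rw [h] at h1
    have := hpos s
    simp [← h1] at this

theorem inner_starGradient_tangent_eq_zero (hf : ContDiff ℝ ∞ f)
    (hfpos : ∀ p ∈ Metric.sphere (0 : R4) 1, 0 < f p) {p v : R4}
    (hp : p ∈ Metric.sphere (0 : R4) 1) (hpv : ⟪p, v⟫ = 0) :
    ⟪starGradient f (√(f p) • p), fderiv ℝ (fun x => √(f x) • x) p v⟫ = 0 := by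
  obtain ⟨c, hc0, hc, hcs⟩ := exists_curve_in_sphere (mem_sphere_zero_iff_norm.1 hp) hpv
  subst hc0
  have h1 := (differentiableAt_sqrt_smul hf (hfpos _ hp)).hasFDerivAt.comp_hasDerivAt (0 : ℝ) hc
  have h2 := (hasFDerivAt_starHamiltonian hf hfpos (√(f (c 0)) • c 0)).comp_hasDerivAt (0 : ℝ) h1
  refine h2.unique ((hasDerivAt_const (0 : ℝ) (1 : ℝ)).congr_of_eventuallyEq ?_)
  exact Eventually.of_forall fun s =>
    starHamiltonian_sqrt_smul hfpos (mem_sphere_zero_iff_norm.2 (hcs s))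

theorem deriv_mem_tangent (hf : ContDiff ℝ ∞ f)
    (hfpos : ∀ p ∈ Metric.sphere (0 : R4) 1, 0 < f p) {γ : ℝ → R4}
    (hγ : ∀ t, starHamiltonian f (γ t) = 1) {t : ℝ} (hd : DifferentiableAt ℝ γ t) :
    deriv γ t ∈ fderiv ℝ (fun x => √(f x) • x) (‖γ t‖⁻¹ • γ t) ''
      {v : R4 | ⟪‖γ t‖⁻¹ • γ t, v⟫ = 0} := by
  have hγ0 : ∀ t, γ t ≠ 0 := fun t => (sqrt_smul_inv_norm_smul_eq (hγ t)).1
  have hp : DifferentiableAt ℝ (fun t => ‖γ t‖⁻¹ • γ t) t :=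
    ((hd.norm ℝ (hγ0 t)).inv (norm_ne_zero_iff.2 (hγ0 t))).smul hd
  refine ⟨deriv (fun t => ‖γ t‖⁻¹ • γ t) t, ?_, ?_⟩
  · have h1 := (hp.hasDerivAt.inner ℝ hp.hasDerivAt).unique
      ((hasDerivAt_const t (1 : ℝ)).congr_of_eventuallyEq (Eventually.of_forall fun s => by
        change ⟪‖γ s‖⁻¹ • γ s, ‖γ s‖⁻¹ • γ s⟫ = 1
        rw [real_inner_self_eq_norm_sq,
          mem_sphere_zero_iff_norm.1 (inv_norm_smul_mem_sphere (hγ0 s)), one_pow]))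
    have h2 := real_inner_comm (deriv (fun t => ‖γ t‖⁻¹ • γ t) t) (‖γ t‖⁻¹ • γ t)
    change ⟪‖γ t‖⁻¹ • γ t, deriv (fun t => ‖γ t‖⁻¹ • γ t) t⟫ = 0
    linarith
  · have h1 := (differentiableAt_sqrt_smul hf
      (hfpos _ (inv_norm_smul_mem_sphere (hγ0 t)))).hasFDerivAt.comp_hasDerivAt t hp.hasDerivAt
    rw [← h1.deriv]
    congr 1
    exact funext fun s => (sqrt_smul_inv_norm_smul_eq (hγ s)).2

end ReebOrbit

end

/-- Rabinowitz: the contact form λ_st|TS on a star-shaped hypersurface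
S = {√(f(p))·p : p ∈ S³} has a closed Reeb orbit. The smooth function
f : S³ → (0,∞) is encoded by a smooth extension to ℝ⁴ which is positive
on the unit sphere. -/
theorem starshaped_reeb_orbit
    (f : R4 → ℝ) (hf : ContDiff ℝ ∞ f)
    (hfpos : ∀ p ∈ Metric.sphere (0 : R4) 1, 0 < f p)
    (Φ : R4 → R4) (hΦ : ∀ x, Φ x = Real.sqrt (f x) • x)
    (S : Set R4) (hS : S = Φ '' Metric.sphere (0 : R4) 1) :
    ∃ (T : ℝ) (γ : ℝ → R4), 0 < T ∧ ContDiff ℝ ∞ γ ∧ (∃ t s, γ t ≠ γ s) ∧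
      (∀ t, γ t ∈ S) ∧
      (∀ t, γ (t + T) = γ t) ∧
      (∀ t : ℝ, ∃ p ∈ Metric.sphere (0 : R4) 1, γ t = Φ p ∧
        -- γ′(t) is tangent to S at γ(t):
        deriv γ t ∈ (fderiv ℝ Φ p) '' {v : R4 | ⟪p, v⟫ = 0} ∧
        -- γ′(t) lies in the kernel of dα = ω_st restricted to T_{γ(t)}S:
        (∀ w ∈ (fderiv ℝ Φ p) '' {v : R4 | ⟪p, v⟫ = 0},
          omegaSt (deriv γ t) w = 0) ∧
        -- normalisation λ_st(γ(t))(γ′(t)) = 1: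
        lambdaSt (γ t) (deriv γ t) = 1) := by
  obtain rfl : Φ = fun x => √(f x) • x := funext hΦ
  obtain ⟨T, γ, hT, hper, hlev, hder⟩ := exists_periodic_orbit_on_level_one hf hfpos
  have hγ : ∀ t, γ t ≠ 0 ∧ √(f (‖γ t‖⁻¹ • γ t)) • ‖γ t‖⁻¹ • γ t = γ t := fun t =>
    sqrt_smul_inv_norm_smul_eq (hlev t)
  have hlam : ∀ t, lambdaSt (γ t) (deriv γ t) = 1 := fun t => by
    rw [lambdaSt, omegaSt_eq_inner, (hder t).deriv, inner_mixedJ_mixedJ, real_inner_comm,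
      inner_starGradient_self hf hfpos, hlev]
    norm_num
  refine ⟨T, γ, hT, ?_, ?_, fun t => ?_, hper, fun t =>
    ⟨‖γ t‖⁻¹ • γ t, inv_norm_smul_mem_sphere (hγ t).1, (hγ t).2.symm,
      deriv_mem_tangent hf hfpos hlev (hder t).differentiableAt, ?_, hlam t⟩⟩
  · exact contDiff_of_hasDerivAt_autonomous hder fun t =>
      contDiff_mixedJ_self.contDiffAt.comp _ (contDiffAt_starGradient hf hfpos (hγ t).1)
  · by_contra! hcon
    have h0 : γ = fun _ => γ 0 := funext fun t => hcon t 0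
    have h1 := hlam 0
    rw [h0] at h1
    simp [lambdaSt, omegaSt] at h1
  · rw [hS]
    exact ⟨_, inv_norm_smul_mem_sphere (hγ t).1, (hγ t).2⟩
  · rintro _ ⟨v, hv, rfl⟩
    have h1 := inner_starGradient_tangent_eq_zero hf hfpos
      (inv_norm_smul_mem_sphere (hγ t).1) hv
    rw [(hγ t).2] at h1
    rw [omegaSt_eq_inner, (hder t).deriv, mixedJ_mixedJ, inner_neg_left, h1, neg_zero]
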